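/- For every odd prime q and every ε > 0 there exists a constant C_{ε,q} such that the following holds. Let R = q^{2m} with m ∈ ℕ, m ≥ 1, and let F : ℚ_q² → ℂ be a Schwartz function with Fourier support contained in Ξ_{1/R}. Then ∫_{ℚ_q²} |F|⁶ dμ² ≤ C_{ε,q} (log R)^{12+ε} (∑_τ ‖F_τ‖_{L∞(ℚ_q²)}²)² (∑_τ ∫_{ℚ_q²} |F_τ|² dμ²), where both sums run over all intervals τ ⊂ ℤ_q of length R^{-1/2}, and ‖·‖_{L∞} denotes the supremum norm. -/

import Mathlib

open MeasureTheory

noncomputable instance (q : ℕ) [Fact q.Prime] : MeasurableSpace ℚ_[q] := borel _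
instance (q : ℕ) [Fact q.Prime] : BorelSpace ℚ_[q] := ⟨rfl⟩

/-- The Fourier transform on `ℚ_q²` with respect to the additive character `χ`
and the Haar measure `μ`. -/
noncomputable def qpFourier (q : ℕ) [Fact q.Prime] (μ : Measure ℚ_[q]) [SigmaFinite μ]
    (χ : ℚ_[q] → ℂ) (F : ℚ_[q] × ℚ_[q] → ℂ) (ξη : ℚ_[q] × ℚ_[q]) : ℂ :=
  ∫ x, F x * χ (-(ξη.1 * x.1 + ξη.2 * x.2)) ∂(μ.prod μ)

/-- The Fourier projection `F_τ` of `F` to the frequency strip `τ × ℚ_q`. -/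
noncomputable def qpProj (q : ℕ) [Fact q.Prime] (μ : Measure ℚ_[q]) [SigmaFinite μ]
    (χ : ℚ_[q] → ℂ) (F : ℚ_[q] × ℚ_[q] → ℂ) (τ : Set ℚ_[q]) (x : ℚ_[q] × ℚ_[q]) : ℂ :=
  ∫ ξη in τ ×ˢ (Set.univ : Set ℚ_[q]),
    qpFourier q μ χ F ξη * χ (ξη.1 * x.1 + ξη.2 * x.2) ∂(μ.prod μ)

/-- The interval `{ξ ∈ ℤ_q : |ξ - a| ≤ q^{-ℓ}}`; as `a` runs over `0, …, q^ℓ - 1` these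
enumerate all intervals of length `q^{-ℓ}` inside `ℤ_q`. -/
def qpItv (q : ℕ) [Fact q.Prime] (ℓ a : ℕ) : Set ℚ_[q] :=
  {ξ : ℚ_[q] | ‖ξ - (a : ℚ_[q])‖ ≤ (q : ℝ) ^ (-(ℓ : ℤ))}


section Basics

variable {q : ℕ} [Fact q.Prime]

/-- uniformly locally constant at scale `r`, supported in the ball of radius `r⁻¹`. -/
def Gd {E : Type*} [Zero E] (r : ℝ) (f : ℚ_[q] × ℚ_[q] → E) : Prop :=
  (∀ x t, ‖t‖ ≤ r → f (x + t) = f x) ∧ (∀ x, r⁻¹ < ‖x‖ → f x = 0)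

theorem Gd.isLocallyConstant {E : Type*} [Zero E] {r : ℝ} (hr : 0 < r)
    {f : ℚ_[q] × ℚ_[q] → E} (h : Gd r f) : IsLocallyConstant f := by
  rw [IsLocallyConstant.iff_eventually_eq]
  intro x
  filter_upwards [Metric.closedBall_mem_nhds x hr] with y hy
  have := h.1 x (y - x) (by simpa [dist_eq_norm] using hy)
  simpa using this

theorem Gd.integrable {E : Type*} [NormedAddCommGroup E] {r : ℝ} (hr : 0 < r)
    (μ : Measure ℚ_[q]) [μ.IsAddHaarMeasure] [SigmaFinite μ]
    {f : ℚ_[q] × ℚ_[q] → E} (h : Gd r f) : Integrable f (μ.prod μ) := by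
  apply Continuous.integrable_of_hasCompactSupport (h.isLocallyConstant hr).continuous
  apply HasCompactSupport.of_support_subset_isCompact (isCompact_closedBall 0 r⁻¹)
  intro x hx
  by_contra hc
  apply hx
  apply h.2
  simpa using hc

theorem Gd.bdd {r : ℝ} (hr : 0 < r)
    {f : ℚ_[q] × ℚ_[q] → ℂ} (h : Gd r f) : BddAbove (Set.range fun x => ‖f x‖) := by
  have hc : HasCompactSupport f := by
    apply HasCompactSupport.of_support_subset_isCompact (isCompact_closedBall 0 r⁻¹)
    intro x hx
    by_contra hc
    apply hx
    apply h.2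
    simpa using hc
  obtain ⟨C, hC⟩ := (h.isLocallyConstant hr).continuous.bounded_above_of_compact_support hc
  exact ⟨C, by rintro _ ⟨x, rfl⟩; exact hC x⟩

theorem Gd.mono {E : Type*} [Zero E] {r s : ℝ} (hs : 0 < s) (hsr : s ≤ r)
    {f : ℚ_[q] × ℚ_[q] → E} (h : Gd r f) : Gd s f :=
  ⟨fun x t ht => h.1 x t (ht.trans hsr), fun x hx => h.2 x
    (lt_of_le_of_lt (inv_anti₀ hs hsr) hx)⟩

theorem integral_zero_of_shift (μ : Measure ℚ_[q]) [μ.IsAddHaarMeasure] [SigmaFinite μ]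
    (f : ℚ_[q] × ℚ_[q] → ℂ) (u : ℚ_[q] × ℚ_[q]) (z : ℂ) (hz : z ≠ 1)
    (h : ∀ x, f (x + u) = z * f x) : ∫ x, f x ∂(μ.prod μ) = 0 := by
  have h1 : ∫ x, f (x + u) ∂(μ.prod μ) = ∫ x, f x ∂(μ.prod μ) :=
    integral_add_right_eq_self f u
  simp only [h] at h1
  rw [integral_const_mul] at h1
  have h2 : (z - 1) * ∫ x, f x ∂(μ.prod μ) = 0 := by rw [sub_mul, h1]; simp
  rcases mul_eq_zero.1 h2 with h3 | h3
  · exact absurd (sub_eq_zero.1 h3) hz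
  · exact h3

/-- Pythagoras. -/
theorem pythag {ι : Type*} (ν : Measure (ℚ_[q] × ℚ_[q])) (s : Finset ι)
    (e : ι → ℚ_[q] × ℚ_[q] → ℂ)
    (hInt0 : ∀ i ∈ s, ∀ j ∈ s, Integrable (fun x => e i x * (starRingEnd ℂ) (e j x)) ν)
    (horth : ∀ i ∈ s, ∀ j ∈ s, i ≠ j → ∫ x, e i x * (starRingEnd ℂ) (e j x) ∂ν = 0) :
    ∫ x, ‖∑ i ∈ s, e i x‖ ^ 2 ∂ν = ∫ x, ∑ i ∈ s, ‖e i x‖ ^ 2 ∂ν := by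
  classical
  have key : ∀ z : ℂ, ((‖z‖ ^ 2 : ℝ) : ℂ) = z * (starRingEnd ℂ) z := by
    intro z; rw [Complex.mul_conj, Complex.normSq_eq_norm_sq]
  have : ((∫ x, ‖∑ i ∈ s, e i x‖ ^ 2 ∂ν : ℝ) : ℂ) = ((∫ x, ∑ i ∈ s, ‖e i x‖ ^ 2 ∂ν : ℝ) : ℂ) := by
    rw [← integral_complex_ofReal, ← integral_complex_ofReal]
    have e1 : ∀ x, ((‖∑ i ∈ s, e i x‖ ^ 2 : ℝ) : ℂ)
        = ∑ i ∈ s, ∑ j ∈ s, e i x * (starRingEnd ℂ) (e j x) := by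
      intro x
      rw [key, map_sum, Finset.sum_mul_sum]
    have e2 : ∀ x, ((∑ i ∈ s, ‖e i x‖ ^ 2 : ℝ) : ℂ)
        = ∑ i ∈ s, e i x * (starRingEnd ℂ) (e i x) := by
      intro x
      rw [Complex.ofReal_sum]
      exact Finset.sum_congr rfl fun i _ => key _
    simp only [e1, e2]
    rw [integral_finset_sum, integral_finset_sum]
    · apply Finset.sum_congr rfl
      intro i hi
      rw [integral_finset_sum _ (fun j hj => hInt0 i hi j hj)]
      rw [Finset.sum_eq_single i]
      · intro j hj hji
        exact horth i hi j hj hji.symm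
      · intro h; exact absurd hi h
    · intro i hi; exact hInt0 i hi i hi
    · intro i hi
      exact integrable_finset_sum _ (fun j hj => hInt0 i hi j hj)
  exact_mod_cast this

/-! ### norms -/

theorem qpos : (0 : ℝ) < q := by exact_mod_cast (Fact.out : q.Prime).pos
theorem qgt1 : (1 : ℝ) < q := by exact_mod_cast (Fact.out : q.Prime).one_lt

theorem norm_add3 {a b : ℚ_[q]} {r : ℝ} (ha : ‖a‖ ≤ r) (hb : ‖b‖ ≤ r) : ‖a + b‖ ≤ r :=
  (Padic.nonarchimedean a b).trans (max_le ha hb)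

theorem norm_sub3 {a b : ℚ_[q]} {r : ℝ} (ha : ‖a‖ ≤ r) (hb : ‖b‖ ≤ r) : ‖a - b‖ ≤ r := by
  rw [sub_eq_add_neg]; exact norm_add3 ha (by simpa using hb)

theorem norm_two (hq2 : q ≠ 2) : ‖(2 : ℚ_[q])‖ = 1 := by
  have : ‖((2 : ℕ) : ℚ_[q])‖ = 1 := by
    rw [Padic.norm_natCast_eq_one_iff]
    exact (Nat.coprime_primes Fact.out Nat.prime_two).2 hq2
  simpa using this

theorem norm_nat_le_one (c : ℕ) : ‖(c : ℚ_[q])‖ ≤ 1 := by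
  simpa using Padic.norm_int_le_one (p := q) (c : ℤ)

theorem norm_sub_le_iff (c d l : ℕ) :
    ‖(c : ℚ_[q]) - d‖ ≤ (q : ℝ) ^ (-(l : ℤ)) ↔ c ≡ d [MOD q ^ l] := by
  have := Padic.norm_int_le_pow_iff_dvd (p := q) ((c : ℤ) - d) l
  push_cast at this
  rw [this, Nat.modEq_iff_dvd, ← dvd_neg]
  push_cast
  ring_nf

theorem norm_sub_gt (c d l : ℕ) (h : ¬ c ≡ d [MOD q ^ l]) :
    (q : ℝ) ^ (-(l : ℤ) + 1) ≤ ‖(c : ℚ_[q]) - d‖ := by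
  rw [← norm_sub_le_iff] at h
  by_contra hc
  exact h ((Padic.norm_le_pow_iff_norm_lt_pow_add_one _ _).2 (not_le.1 hc))

end Basics

section Char

variable {q : ℕ} [Fact q.Prime]

/-- the hypotheses on the character -/
structure ChiOK (χ : ℚ_[q] → ℂ) : Prop where
  mul : ∀ x y : ℚ_[q], χ (x + y) = χ x * χ y
  norm : ∀ x : ℚ_[q], ‖χ x‖ = 1
  triv : ∀ x : ℚ_[q], ‖x‖ ≤ 1 → χ x = 1
  nontriv : ∃ x : ℚ_[q], ‖x‖ ≤ (q : ℝ) ∧ χ x ≠ 1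

variable {χ : ℚ_[q] → ℂ}

theorem ChiOK.zero (h : ChiOK χ) : χ 0 = 1 := h.triv 0 (by simp)

theorem ChiOK.ne_zero (h : ChiOK χ) (x) : χ x ≠ 0 := by
  intro h0; have := h.norm x; simp [h0] at this

theorem ChiOK.neg (h : ChiOK χ) (x : ℚ_[q]) : χ (-x) = (χ x)⁻¹ := by
  have := h.mul x (-x)
  rw [add_neg_cancel, h.zero] at this
  exact eq_inv_of_mul_eq_one_right this.symm

theorem ChiOK.conj (h : ChiOK χ) (x : ℚ_[q]) : (starRingEnd ℂ) (χ x) = χ (-x) := by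
  rw [h.neg, Complex.inv_def, Complex.normSq_eq_norm_sq, h.norm]; simp

theorem ChiOK.eq_of_sub (h : ChiOK χ) {x y : ℚ_[q]} (hxy : ‖x - y‖ ≤ 1) : χ x = χ y := by
  have := h.mul (x - y) y
  rw [h.triv _ hxy] at this
  simpa using this

theorem ChiOK.continuous (h : ChiOK χ) : Continuous χ := by
  apply IsLocallyConstant.continuous
  rw [IsLocallyConstant.iff_eventually_eq]
  intro x
  filter_upwards [Metric.closedBall_mem_nhds x one_pos] with y hy
  exact h.eq_of_sub (by simpa [dist_eq_norm] using hy)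

/-- nontriviality with size control -/
theorem ChiOK.exists_ne (h : ChiOK χ) (ξ : ℚ_[q]) (k : ℤ) (hξ : (q : ℝ) ^ (1 - k) ≤ ‖ξ‖) :
    ∃ v : ℚ_[q], ‖v‖ ≤ (q : ℝ) ^ k ∧ χ (ξ * v) ≠ 1 := by
  obtain ⟨x, hx, hx1⟩ := h.nontriv
  have hq := qpos (q := q)
  have hp : (0 : ℝ) < (q : ℝ) ^ (1 - k) := zpow_pos hq _
  have h0 : ξ ≠ 0 := by
    intro h0; rw [h0, norm_zero] at hξ; linarith
  refine ⟨x / ξ, ?_, ?_⟩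
  · rw [norm_div, div_le_iff₀ (lt_of_lt_of_le hp hξ)]
    calc ‖x‖ ≤ q := hx
      _ = (q : ℝ) ^ k * (q : ℝ) ^ (1 - k) := by
          rw [← zpow_add₀ hq.ne']; simp
      _ ≤ _ := by gcongr
  · rwa [mul_div_cancel₀ _ h0]

theorem ChiOK.exists_ne' (h : ChiOK χ) (ξ : ℚ_[q]) (k : ℤ) (hξ : (q : ℝ) ^ (-k) < ‖ξ‖) :
    ∃ v : ℚ_[q], ‖v‖ ≤ (q : ℝ) ^ k ∧ χ (ξ * v) ≠ 1 := by
  apply h.exists_ne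
  by_contra hc
  push Not at hc
  have := (Padic.norm_le_pow_iff_norm_lt_pow_add_one ξ (-k)).2 (by rwa [neg_add_eq_sub])
  linarith

end Char

section Quasi

variable {q : ℕ} [Fact q.Prime]

def UU (q : ℕ) [Fact q.Prime] (l c : ℕ) : Set (ℚ_[q] × ℚ_[q]) :=
  {u | ‖u.1 + 2 * (c : ℚ_[q]) * u.2‖ ≤ (q : ℝ) ^ (l : ℤ) ∧ ‖u.2‖ ≤ (q : ℝ) ^ (2 * l : ℤ)}

def TT (q : ℕ) [Fact q.Prime] (k j a : ℕ) : Set (ℚ_[q] × ℚ_[q]) :=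
  {u | ‖u.1 + 2 * (a : ℚ_[q]) * u.2‖ ≤ (q : ℝ) ^ (k : ℤ) ∧ ‖u.2‖ ≤ (q : ℝ) ^ (k + j : ℤ)}

noncomputable def ph (χ : ℚ_[q] → ℂ) (c : ℕ) (u : ℚ_[q] × ℚ_[q]) : ℂ :=
  χ ((c : ℚ_[q]) * u.1 + (c : ℚ_[q]) ^ 2 * u.2)

def QI (χ : ℚ_[q] → ℂ) (l c : ℕ) (f : ℚ_[q] × ℚ_[q] → ℂ) : Prop :=
  ∀ x u, u ∈ UU q l c → f (x + u) = ph χ c u * f x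

variable {χ : ℚ_[q] → ℂ}

theorem norm_two_le : ‖(2 : ℚ_[q])‖ ≤ 1 := by
  simpa using norm_nat_le_one (q := q) 2

theorem norm_mul3 {a b : ℚ_[q]} {r s t : ℝ} (ha : ‖a‖ ≤ r) (hb : ‖b‖ ≤ s) (h : r * s = t) :
    ‖a * b‖ ≤ t := by
  rw [norm_mul, ← h]
  exact mul_le_mul ha hb (norm_nonneg _) ((norm_nonneg _).trans ha)

theorem TT_sub_UU {k j a l c : ℕ} (hkl : k ≤ l) (hjl : j ≤ k) (hc : c ≡ a [MOD q ^ j])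
    {u : ℚ_[q] × ℚ_[q]} (hu : u ∈ TT q k j a) : u ∈ UU q l c := by
  obtain ⟨h1, h2⟩ := hu
  have hq := qpos (q := q)
  have hq1 := (qgt1 (q := q)).le
  refine ⟨?_, h2.trans (zpow_le_zpow_right₀ hq1 (by omega))⟩
  refine le_trans ?_ (zpow_le_zpow_right₀ hq1 (show (k : ℤ) ≤ l by omega))
  have e : u.1 + 2 * (c : ℚ_[q]) * u.2
    = (u.1 + 2 * (a : ℚ_[q]) * u.2) + 2 * (((c : ℚ_[q]) - a) * u.2) := by ring
  rw [e]
  refine norm_add3 h1 ?_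
  refine norm_mul3 norm_two_le (norm_mul3 ((norm_sub_le_iff _ _ _).2 hc) h2 rfl) ?_
  rw [one_mul, ← zpow_add₀ hq.ne']
  congr 1
  omega

theorem UU_eq_TT (l c : ℕ) : UU q l c = TT q l l c := by
  unfold UU TT
  rw [show (2 * l : ℤ) = l + l by ring]

theorem UU_mono {l l' c c' : ℕ} (hl : l ≤ l') (hc : c' ≡ c [MOD q ^ l])
    {u : ℚ_[q] × ℚ_[q]} (hu : u ∈ UU q l c) : u ∈ UU q l' c' := by
  rw [UU_eq_TT] at hu
  exact TT_sub_UU hl le_rfl hc hu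

theorem ph_congr (hχ : ChiOK χ) {l c c' : ℕ} (hc : c' ≡ c [MOD q ^ l])
    {u : ℚ_[q] × ℚ_[q]} (hu : u ∈ UU q l c) : ph χ c' u = ph χ c u := by
  apply hχ.eq_of_sub
  obtain ⟨h1, h2⟩ := hu
  have hq := qpos (q := q)
  have hd := (norm_sub_le_iff (q := q) _ _ _).2 hc
  have e : (c' : ℚ_[q]) * u.1 + (c' : ℚ_[q]) ^ 2 * u.2 - ((c : ℚ_[q]) * u.1 + (c : ℚ_[q]) ^ 2 * u.2)
    = ((c' : ℚ_[q]) - c) * (u.1 + 2 * (c : ℚ_[q]) * u.2)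
      + ((c' : ℚ_[q]) - c) * (((c' : ℚ_[q]) - c) * u.2) := by ring
  rw [e]
  refine norm_add3 (norm_mul3 hd h1 ?_) (norm_mul3 hd (norm_mul3 hd h2 rfl) ?_)
  · rw [← zpow_add₀ hq.ne']; simp
  · rw [← zpow_add₀ hq.ne', ← zpow_add₀ hq.ne',
      show (-(l : ℤ) + (-l + 2 * l)) = 0 by ring, zpow_zero]

theorem norm_ph (hχ : ChiOK χ) (c : ℕ) (u) : ‖ph χ c u‖ = 1 := hχ.norm _

theorem QI.mono (hχ : ChiOK χ) {l l' c c' : ℕ} {f : ℚ_[q] × ℚ_[q] → ℂ} (h : QI χ l' c' f)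
    (hl : l ≤ l') (hc : c' ≡ c [MOD q ^ l]) : QI χ l c f := by
  intro x u hu
  rw [h x u (UU_mono hl hc hu), ph_congr hχ hc hu]

theorem QI.sum {ι : Type*} {l c : ℕ} (s : Finset ι) (f : ι → ℚ_[q] × ℚ_[q] → ℂ)
    (h : ∀ i ∈ s, QI χ l c (f i)) : QI χ l c (fun x => ∑ i ∈ s, f i x) := by
  intro x u hu
  rw [Finset.mul_sum]
  exact Finset.sum_congr rfl fun i hi => h i hi x u hu

theorem QI.norm (hχ : ChiOK χ) {l c : ℕ} {f : ℚ_[q] × ℚ_[q] → ℂ} (h : QI χ l c f) {x u}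
    (hu : u ∈ UU q l c) : ‖f (x + u)‖ = ‖f x‖ := by
  rw [h x u hu, norm_mul, norm_ph hχ, one_mul]

theorem low_orth (hχ : ChiOK χ) (μ : Measure ℚ_[q]) [μ.IsAddHaarMeasure] [SigmaFinite μ]
    {l c c' : ℕ} {f f' : ℚ_[q] × ℚ_[q] → ℂ} (h : QI χ l c f) (h' : QI χ l c' f')
    (hc : ¬ c ≡ c' [MOD q ^ l]) :
    ∫ x, f x * (starRingEnd ℂ) (f' x) ∂(μ.prod μ) = 0 := by
  obtain ⟨v, hv, hv1⟩ := hχ.exists_ne ((c : ℚ_[q]) - c') l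
    (by have := norm_sub_gt (q := q) c c' l hc; rwa [neg_add_eq_sub] at this)
  have hm : ∀ d : ℕ, ((v, 0) : ℚ_[q] × ℚ_[q]) ∈ UU q l d := by
    intro d
    refine ⟨by simpa using hv, by simpa using (zpow_pos qpos _).le⟩
  refine integral_zero_of_shift μ _ (v, 0) _ hv1 ?_
  intro x
  rw [h x _ (hm _), h' x _ (hm _), map_mul, ph, ph, hχ.conj, sub_mul, sub_eq_add_neg,
    hχ.mul (c * v) (-(c' * v))]
  simp only [mul_zero, add_zero]
  ring

theorem high_orth (hχ : ChiOK χ) (hq2 : q ≠ 2)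
    (μ : Measure ℚ_[q]) [μ.IsAddHaarMeasure] [SigmaFinite μ]
    {l c c' d d' : ℕ} {h f f' : ℚ_[q] × ℚ_[q] → ℂ}
    (hh : ∀ x u, u ∈ UU q l c → h (x + u) = h x)
    (hf : QI χ (l + 1) d f) (hf' : QI χ (l + 1) d' f')
    (hd : d ≡ c' [MOD q ^ l]) (hd' : d' ≡ c' [MOD q ^ l])
    (hdd : ¬ d ≡ d' [MOD q ^ (l + 1)])
    (hc : ¬ c ≡ c' [MOD q ^ l]) :
    ∫ x, h x * (f x * (starRingEnd ℂ) (f' x)) ∂(μ.prod μ) = 0 := by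
  have hq := qpos (q := q)
  obtain ⟨v, hv, hv1⟩ := hχ.exists_ne ((d : ℚ_[q]) - d') (l + 1 : ℕ)
    (by have := norm_sub_gt (q := q) d d' (l + 1) hdd; rwa [neg_add_eq_sub] at this)
  have hm : ∀ e : ℕ, ((v, 0) : ℚ_[q] × ℚ_[q]) ∈ UU q (l + 1) e := by
    intro d
    refine ⟨by simpa using hv, by simpa using (zpow_pos qpos _).le⟩
  have hcn := norm_sub_gt (q := q) c c' l hc
  have hcp : 0 < ‖(c : ℚ_[q]) - c'‖ := lt_of_lt_of_le (zpow_pos hq _) hcn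
  have hc0 : (c : ℚ_[q]) - c' ≠ 0 := norm_pos_iff.1 hcp
  have h20 : (2 : ℚ_[q]) ≠ 0 := by norm_num
  obtain ⟨w, hw⟩ : ∃ w : ℚ_[q], w = v / (2 * ((c' : ℚ_[q]) - c)) := ⟨_, rfl⟩
  have hc0' : (c' : ℚ_[q]) - c ≠ 0 := by
    intro h; apply hc0; linear_combination -h
  have hvw : v = 2 * ((c' : ℚ_[q]) - c) * w := by
    rw [hw]; field_simp
  have hwn : ‖w‖ ≤ (q : ℝ) ^ (2 * l : ℤ) := by
    rw [hw, norm_div, norm_mul, norm_two hq2, one_mul, norm_sub_rev, div_le_iff₀ hcp]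
    calc ‖v‖ ≤ _ := hv
      _ = (q : ℝ) ^ (2 * l : ℤ) * (q : ℝ) ^ (-(l : ℤ) + 1) := by
        rw [← zpow_add₀ hq.ne']; congr 1; push_cast; ring
      _ ≤ _ := by gcongr
  have hu : ((-(2 * c * w), w) : ℚ_[q] × ℚ_[q]) ∈ UU q l c :=
    ⟨by simpa using (zpow_pos qpos _).le, hwn⟩
  have hu' : ((-(2 * c' * w), w) : ℚ_[q] × ℚ_[q]) ∈ UU q l c' :=
    ⟨by simpa using (zpow_pos qpos _).le, hwn⟩
  have hsum : ((-(2 * c * w), w) : ℚ_[q] × ℚ_[q]) = (v, 0) + (-(2 * c' * w), w) := by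
    ext
    · simp [hvw]; ring
    · simp
  refine integral_zero_of_shift μ _ (-(2 * c * w), w) _ hv1 ?_
  intro x
  rw [hh x _ hu, hsum, ← add_assoc, (hf.mono hχ (Nat.le_succ l) hd) _ _ hu',
    (hf'.mono hχ (Nat.le_succ l) hd') _ _ hu', hf x _ (hm _), hf' x _ (hm _)]
  simp only [map_mul]
  have e1 : ph χ c' (-(2 * c' * w), w) * (starRingEnd ℂ) (ph χ c' (-(2 * c' * w), w)) = 1 := by
    rw [Complex.mul_conj, Complex.normSq_eq_norm_sq, norm_ph hχ]; simp
  have e2 : ph χ d (v, 0) * (starRingEnd ℂ) (ph χ d' (v, 0)) = χ (((d : ℚ_[q]) - d') * v) := by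
    rw [ph, ph, hχ.conj, sub_mul, sub_eq_add_neg, hχ.mul (d * v) (-(d' * v))]
    simp only [mul_zero, add_zero]
  rw [← e2]
  linear_combination (h x * (ph χ d (v, 0) * (starRingEnd ℂ) (ph χ d' (v, 0)))
    * (f x * (starRingEnd ℂ) (f' x))) * e1

theorem bil_orth (hχ : ChiOK χ) (hq2 : q ≠ 2)
    (μ : Measure ℚ_[q]) [μ.IsAddHaarMeasure] [SigmaFinite μ]
    {k j a t t' c₁ c₂ c₃ c₄ : ℕ} (hjk : j < k) {w f₁ f₂ f₃ f₄ : ℚ_[q] × ℚ_[q] → ℂ}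
    (hw : ∀ x u, u ∈ TT q k j a → w (x + u) = w x)
    (h₁ : QI χ k c₁ f₁) (h₂ : QI χ k c₂ f₂) (h₃ : QI χ k c₃ f₃) (h₄ : QI χ k c₄ f₄)
    (ht : t ≡ a [MOD q ^ j]) (ht' : t' ≡ a [MOD q ^ j]) (htt : ¬ t ≡ t' [MOD q ^ (j + 1)])
    (hc₁ : c₁ ≡ t [MOD q ^ (j + 1)]) (hc₂ : c₂ ≡ t [MOD q ^ (j + 1)])
    (hc₃ : c₃ ≡ t' [MOD q ^ (j + 1)]) (hc₄ : c₄ ≡ t' [MOD q ^ (j + 1)])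
    (hne : ¬ (c₁ ≡ c₂ [MOD q ^ k] ∧ c₃ ≡ c₄ [MOD q ^ k])) :
    ∫ x, (w x * (f₁ x * f₃ x)) * (starRingEnd ℂ) (w x * (f₂ x * f₄ x)) ∂(μ.prod μ) = 0 := by
  have hq := qpos (q := q)
  have hq1 := (qgt1 (q := q)).le
  have hdvd : q ^ j ∣ q ^ (j + 1) := pow_dvd_pow _ (Nat.le_succ j)
  have m₁ := (hc₁.of_dvd hdvd).trans ht
  have m₂ := (hc₂.of_dvd hdvd).trans ht
  have m₃ := (hc₃.of_dvd hdvd).trans ht'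
  have m₄ := (hc₄.of_dvd hdvd).trans ht'
  -- the frequency
  obtain ⟨ξ, hξ⟩ : ∃ ξ : ℚ_[q], ξ = c₁ - c₂ + c₃ - c₄ := ⟨_, rfl⟩
  obtain ⟨η, hη⟩ : ∃ η : ℚ_[q], η = c₁ ^ 2 - c₂ ^ 2 + c₃ ^ 2 - c₄ ^ 2 := ⟨_, rfl⟩
  have main : ∃ u ∈ TT q k j a, χ (ξ * u.1 + η * u.2) ≠ 1 := by
    by_cases hA : ‖ξ‖ ≤ (q : ℝ) ^ (-(k : ℤ))
    · by_cases hB : ‖η - 2 * a * ξ‖ ≤ (q : ℝ) ^ (-(k + j : ℤ))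
      · exfalso
        apply hne
        have n₁ := (norm_sub_le_iff (q := q) _ _ _).2 m₁
        have n₂ := (norm_sub_le_iff (q := q) _ _ _).2 m₂
        have n₃ := (norm_sub_le_iff (q := q) _ _ _).2 m₃
        have n₄ := (norm_sub_le_iff (q := q) _ _ _).2 m₄
        have k₁ := (norm_sub_le_iff (q := q) _ _ _).2 hc₁
        have k₂ := (norm_sub_le_iff (q := q) _ _ _).2 hc₂
        have k₃ := (norm_sub_le_iff (q := q) _ _ _).2 hc₃
        have k₄ := (norm_sub_le_iff (q := q) _ _ _).2 hc₄
        have e1 : ((c₁ : ℚ_[q]) - c₂) * (((c₁ : ℚ_[q]) - c₃) + (c₂ - c₄))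
            = (η - 2 * a * ξ) - ξ * ((c₃ - a) + (c₄ - a)) := by
          rw [hξ, hη]; ring
        have b1 : ‖((c₁ : ℚ_[q]) - c₂) * (((c₁ : ℚ_[q]) - c₃) + (c₂ - c₄))‖
            ≤ (q : ℝ) ^ (-(k + j : ℤ)) := by
          rw [e1]
          refine norm_sub3 hB (norm_mul3 hA (norm_add3 n₃ n₄) ?_)
          rw [← zpow_add₀ hq.ne']; congr 1; ring
        have b2 : (q : ℝ) ^ (-(j : ℤ)) ≤ ‖((c₁ : ℚ_[q]) - c₃) + (c₂ - c₄)‖ := by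
          by_contra hcon
          push Not at hcon
          have hcon' : ‖((c₁ : ℚ_[q]) - c₃) + (c₂ - c₄)‖ ≤ (q : ℝ) ^ (-((j + 1 : ℕ) : ℤ)) := by
            rw [Padic.norm_le_pow_iff_norm_lt_pow_add_one]
            rwa [show (-((j + 1 : ℕ) : ℤ) + 1) = -(j : ℤ) by push_cast; ring]
          apply htt
          rw [← norm_sub_le_iff]
          have e2 : 2 * ((t : ℚ_[q]) - t') = (((c₁ : ℚ_[q]) - c₃) + (c₂ - c₄))
            - ((c₁ - t) + (c₂ - t)) + ((c₃ - t') + (c₄ - t')) := by ring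
          have : ‖2 * ((t : ℚ_[q]) - t')‖ ≤ (q : ℝ) ^ (-((j + 1 : ℕ) : ℤ)) := by
            rw [e2]
            exact norm_add3 (norm_sub3 hcon' (norm_add3 k₁ k₂)) (norm_add3 k₃ k₄)
          rwa [norm_mul, norm_two hq2, one_mul] at this
        have b3 : ‖(c₁ : ℚ_[q]) - c₂‖ ≤ (q : ℝ) ^ (-(k : ℤ)) := by
          rw [norm_mul] at b1
          have hj : 0 < (q : ℝ) ^ (-(j : ℤ)) := zpow_pos hq _
          have : ‖(c₁ : ℚ_[q]) - c₂‖ * (q : ℝ) ^ (-(j : ℤ))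
              ≤ (q : ℝ) ^ (-(k : ℤ)) * (q : ℝ) ^ (-(j : ℤ)) := by
            rw [← zpow_add₀ hq.ne', ← neg_add]
            exact (mul_le_mul_of_nonneg_left b2 (norm_nonneg _)).trans b1
          exact le_of_mul_le_mul_right this hj
        refine ⟨(norm_sub_le_iff _ _ _).1 b3, (norm_sub_le_iff _ _ _).1 ?_⟩
        have e3 : (c₃ : ℚ_[q]) - c₄ = ξ - (c₁ - c₂) := by rw [hξ]; ring
        rw [e3]
        exact norm_sub3 hA b3
      · push Not at hB
        obtain ⟨v, hv, hv1⟩ := hχ.exists_ne' _ _ hB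
        refine ⟨(-(2 * a * v), v), ⟨?_, hv⟩, ?_⟩
        · simpa using (zpow_pos qpos _).le
        · convert hv1 using 2
          simp only
          ring
    · push Not at hA
      obtain ⟨v, hv, hv1⟩ := hχ.exists_ne' _ _ hA
      refine ⟨(v, 0), ⟨by simpa using hv, ?_⟩, ?_⟩
      · simpa using (zpow_pos qpos _).le
      · simpa using hv1
  obtain ⟨u, hu, hu1⟩ := main
  refine integral_zero_of_shift μ _ u _ hu1 ?_
  intro x
  rw [hw x u hu, h₁ x u (TT_sub_UU le_rfl hjk.le m₁ hu), h₂ x u (TT_sub_UU le_rfl hjk.le m₂ hu),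
    h₃ x u (TT_sub_UU le_rfl hjk.le m₃ hu), h₄ x u (TT_sub_UU le_rfl hjk.le m₄ hu)]
  have e2 : χ (ξ * u.1 + η * u.2) = (ph χ c₁ u * ph χ c₃ u)
      * ((starRingEnd ℂ) (ph χ c₂ u) * (starRingEnd ℂ) (ph χ c₄ u)) := by
    simp only [ph, hχ.conj]
    rw [← hχ.mul, ← hχ.mul, ← hχ.mul, hξ, hη]
    congr 1
    ring
  rw [e2]
  simp only [map_mul]
  ring

end Quasi

section Fam

variable {q : ℕ} [Fact q.Prime]

/-- descendants at level `l` of the node `a` of level `j` -/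
def DD (q l j a : ℕ) : Finset ℕ := (Finset.range (q ^ l)).filter (fun c => c ≡ a [MOD q ^ j])

theorem mem_DD {q l j a c : ℕ} : c ∈ DD q l j a ↔ c < q ^ l ∧ c ≡ a [MOD q ^ j] := by
  simp [DD]

theorem DD_sub {q l j a t : ℕ} (ht : t ≡ a [MOD q ^ j]) : DD q l (j + 1) t ⊆ DD q l j a := by
  intro c hc
  rw [mem_DD] at *
  exact ⟨hc.1, (hc.2.of_dvd (pow_dvd_pow _ (Nat.le_succ j))).trans ht⟩

theorem DD_inj {q l j a c c' : ℕ} (hc : c ∈ DD q l j a) (hc' : c' ∈ DD q l j a)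
    (h : c ≡ c' [MOD q ^ l]) : c = c' := by
  rw [mem_DD] at *
  exact Nat.ModEq.eq_of_lt_of_lt h hc.1 hc'.1

theorem modEq_child (q l c b : ℕ) : c + b * q ^ l ≡ c [MOD q ^ l] := by
  simp [Nat.ModEq]

theorem DD_sum {M : Type*} [AddCommMonoid M] {q l j a : ℕ} (hq : 0 < q) (hjl : j ≤ l)
    (φ : ℕ → M) :
    ∑ c ∈ DD q (l + 1) j a, φ c = ∑ c ∈ DD q l j a, ∑ b ∈ Finset.range q, φ (c + b * q ^ l) := by
  have hql : 0 < q ^ l := pow_pos hq _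
  rw [← Finset.sum_product']
  symm
  refine Finset.sum_nbij' (fun x => x.1 + x.2 * q ^ l) (fun c => (c % q ^ l, c / q ^ l))
    ?_ ?_ ?_ ?_ ?_
  · rintro ⟨c, b⟩ h
    simp only [Finset.mem_product, mem_DD, Finset.mem_range] at h ⊢
    obtain ⟨⟨h1, h2⟩, h3⟩ := h
    refine ⟨?_, ((modEq_child q l c b).of_dvd (pow_dvd_pow _ hjl)).trans h2⟩
    rw [pow_succ]
    nlinarith
  · intro c h
    simp only [Finset.mem_product, mem_DD, Finset.mem_range] at h ⊢
    refine ⟨⟨Nat.mod_lt _ hql, ?_⟩, ?_⟩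
    · exact ((Nat.mod_modEq c (q ^ l)).of_dvd (pow_dvd_pow _ hjl)).trans h.2
    · rw [Nat.div_lt_iff_lt_mul hql, mul_comm, ← pow_succ]; exact h.1
  · rintro ⟨c, b⟩ h
    simp only [Finset.mem_product, mem_DD, Finset.mem_range] at h ⊢
    obtain ⟨⟨h1, h2⟩, h3⟩ := h
    ext
    · simp [Nat.mod_eq_of_lt h1]
    · simp [Nat.add_mul_div_right _ _ hql, Nat.div_eq_of_lt h1]
  · intro c h
    simp only
    rw [mul_comm]; exact Nat.mod_add_div c _
  · intro x _; rfl

theorem child_ne {q l c b b' : ℕ} (hq : 0 < q) (hb : b < q) (hb' : b' < q) (hne : b ≠ b') :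
    ¬ c + b * q ^ l ≡ c + b' * q ^ l [MOD q ^ (l + 1)] := by
  intro h
  have h1 := Nat.ModEq.add_left_cancel' c h
  rw [pow_succ, mul_comm (q ^ l) q] at h1
  have h2 := Nat.ModEq.mul_right_cancel' (pow_pos hq l).ne' h1
  exact hne (Nat.ModEq.eq_of_lt_of_lt h2 hb hb')

structure PruneOK (p : ℂ → ℂ) : Prop where
  zero : p 0 = 0
  norm : ∀ z, ‖p z‖ ≤ ‖z‖
  equi : ∀ w z, ‖w‖ = 1 → p (w * z) = w * p z

structure FamOK (χ : ℚ_[q] → ℂ) (m : ℕ) (p : ℂ → ℂ) (r : ℝ)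
    (ft : ℕ → ℕ → ℚ_[q] × ℚ_[q] → ℂ) : Prop where
  step : ∀ l < m, ∀ c x, ft l c x = ∑ b ∈ Finset.range q, p (ft (l + 1) (c + b * q ^ l) x)
  qi : ∀ l ≤ m, ∀ c, QI χ l c (ft l c)
  gd : ∀ l c, Gd r (ft l c)

def famAux (q : ℕ) [Fact q.Prime] (m : ℕ) (p : ℂ → ℂ) (F : ℕ → ℚ_[q] × ℚ_[q] → ℂ) :
    ℕ → ℕ → ℚ_[q] × ℚ_[q] → ℂ
  | 0 => F
  | n + 1 => fun c x => ∑ b ∈ Finset.range q, p (famAux q m p F n (c + b * q ^ (m - (n + 1))) x)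

variable {χ : ℚ_[q] → ℂ}

theorem QI.prune {p : ℂ → ℂ} (hp : PruneOK p) (hχ : ChiOK χ) {l c : ℕ}
    {f : ℚ_[q] × ℚ_[q] → ℂ} (h : QI χ l c f) : QI χ l c (fun x => p (f x)) := by
  intro x u hu
  simp only
  rw [h x u hu, hp.equi _ _ (norm_ph hχ _ _)]

theorem fam_exists {m : ℕ} {p : ℂ → ℂ} {r : ℝ} (hp : PruneOK p) (hχ : ChiOK χ)
    (F : ℕ → ℚ_[q] × ℚ_[q] → ℂ) (hF : ∀ c, QI χ m c (F c)) (hg : ∀ c, Gd r (F c)) :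
    ∃ ft, FamOK χ m p r ft ∧ ft m = F := by
  refine ⟨fun l => famAux q m p F (m - l), ⟨?_, ?_, ?_⟩, by simp [famAux]⟩
  · intro l hl c x
    obtain ⟨n, hn⟩ : ∃ n, m - l = n + 1 := ⟨m - l - 1, by omega⟩
    rw [hn, famAux, show m - (l + 1) = n by omega, show m - (n + 1) = l by omega]
  · suffices H : ∀ n ≤ m, ∀ c, QI χ (m - n) c (famAux q m p F n c) by
      intro l hl c
      have := H (m - l) (by omega) c
      rwa [show m - (m - l) = l by omega] at this
    intro n
    induction n with
    | zero => intro _ c; exact hF c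
    | succ n ih =>
      intro hn c
      rw [famAux]
      apply QI.sum
      intro b _
      have h1 := (ih (by omega) (c + b * q ^ (m - (n + 1)))).prune hp hχ
      exact h1.mono hχ (by omega) (modEq_child _ _ _ _)
  · suffices H : ∀ n c, Gd r (famAux q m p F n c) by
      intro l c; exact H _ c
    intro n
    induction n with
    | zero => intro c; exact hg c
    | succ n ih =>
      intro c
      rw [famAux]
      refine ⟨fun x t ht => ?_, fun x hx => ?_⟩
      · simp only [(ih _).1 x t ht]
      · simp only [(ih _).2 x hx, hp.zero, Finset.sum_const_zero]

end Fam

section Node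

variable {q : ℕ} [Fact q.Prime] {χ : ℚ_[q] → ℂ} {m : ℕ} {p : ℂ → ℂ} {r : ℝ}
  {ft : ℕ → ℕ → ℚ_[q] × ℚ_[q] → ℂ}

/-- square function over descendants -/
noncomputable def gt (q : ℕ) [Fact q.Prime] (ft : ℕ → ℕ → ℚ_[q] × ℚ_[q] → ℂ) (j a l : ℕ)
    (x : ℚ_[q] × ℚ_[q]) : ℝ := ∑ c ∈ DD q l j a, ‖ft l c x‖ ^ 2

noncomputable def gp (q : ℕ) [Fact q.Prime] (p : ℂ → ℂ)
    (ft : ℕ → ℕ → ℚ_[q] × ℚ_[q] → ℂ) (j a l : ℕ)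
    (x : ℚ_[q] × ℚ_[q]) : ℝ := ∑ c ∈ DD q l j a, ‖p (ft l c x)‖ ^ 2

theorem gp_le_gt (hp : PruneOK p) (j a l x) : gp q p ft j a l x ≤ gt q ft j a l x := by
  apply Finset.sum_le_sum
  intro c _
  gcongr
  exact hp.norm _

theorem gt_nonneg (j a l x) : 0 ≤ gt q ft j a l x := by
  unfold gt; positivity

theorem gd_gt (h : FamOK χ m p r ft) (j a l) : Gd r (gt q ft j a l) := by
  unfold gt
  exact ⟨fun x t ht => by simp only [(h.gd _ _).1 x t ht],
    fun x hx => by simp [(h.gd _ _).2 x hx]⟩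

theorem gd_gp (hp : PruneOK p) (h : FamOK χ m p r ft) (j a l) : Gd r (gp q p ft j a l) := by
  unfold gp
  exact ⟨fun x t ht => by simp only [(h.gd _ _).1 x t ht],
    fun x hx => by simp [(h.gd _ _).2 x hx, hp.zero]⟩

theorem energy_step (hχ : ChiOK χ) (hr : 0 < r) (hp : PruneOK p) (h : FamOK χ m p r ft)
    (μ : Measure ℚ_[q]) [μ.IsAddHaarMeasure] [SigmaFinite μ] {j a l : ℕ} (hjl : j ≤ l)
    (hl : l < m) :
    ∫ x, gt q ft j a l x ∂(μ.prod μ) = ∫ x, gp q p ft j a (l + 1) x ∂(μ.prod μ) := by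
  have hq0 : 0 < q := (Fact.out : q.Prime).pos
  unfold gt gp
  simp only [DD_sum hq0 hjl]
  rw [integral_finsetSum, integral_finsetSum]
  · apply Finset.sum_congr rfl
    intro c _
    simp only [h.step l hl]
    apply pythag
    · intro b _ b' _
      refine Gd.integrable hr μ ⟨fun x t ht => ?_, fun x hx => ?_⟩
      · simp only [(h.gd _ _).1 x t ht]
      · simp [(h.gd _ _).2 x hx, hp.zero]
    · intro b hb b' hb' hne
      exact low_orth hχ μ ((h.qi (l + 1) hl _).prune hp hχ) ((h.qi (l + 1) hl _).prune hp hχ)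
        (child_ne hq0 (Finset.mem_range.1 hb) (Finset.mem_range.1 hb') hne)
  · intro c _
    refine Gd.integrable hr μ ⟨fun x t ht => ?_, fun x hx => ?_⟩
    · simp only [(h.gd _ _).1 x t ht]
    · simp [(h.gd _ _).2 x hx, hp.zero]
  · intro c _
    refine Gd.integrable hr μ ⟨fun x t ht => ?_, fun x hx => ?_⟩
    · simp only [(h.gd _ _).1 x t ht]
    · simp [(h.gd _ _).2 x hx]

theorem energy_le (hχ : ChiOK χ) (hr : 0 < r) (hp : PruneOK p) (h : FamOK χ m p r ft)
    (μ : Measure ℚ_[q]) [μ.IsAddHaarMeasure] [SigmaFinite μ] {j a l : ℕ} (hjl : j ≤ l)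
    (hl : l ≤ m) :
    ∫ x, gt q ft j a l x ∂(μ.prod μ) ≤ ∫ x, gt q ft j a m x ∂(μ.prod μ) := by
  obtain ⟨n, hn⟩ : ∃ n, m = l + n := ⟨m - l, by omega⟩
  induction n generalizing l with
  | zero => rw [hn]; rfl
  | succ n ih =>
    rw [energy_step hχ hr hp h μ hjl (by omega)]
    refine le_trans ?_ (ih (l := l + 1) (by omega) (by omega) (by omega))
    exact integral_mono ((gd_gp hp h _ _ _).integrable hr μ) ((gd_gt h _ _ _).integrable hr μ)
      (fun x => gp_le_gt hp _ _ _ x)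

theorem sq_sum_le_card (s : Finset ℕ) (f : ℕ → ℂ) :
    ‖∑ i ∈ s, f i‖ ^ 2 ≤ (s.card : ℝ) * ∑ i ∈ s, ‖f i‖ ^ 2 := by
  calc ‖∑ i ∈ s, f i‖ ^ 2 ≤ (∑ i ∈ s, ‖f i‖) ^ 2 := by
        gcongr; exact norm_sum_le _ _
    _ ≤ _ := sq_sum_le_card_mul_sum_sq

/-- the high-frequency estimate -/
theorem high_est (hχ : ChiOK χ) (hq2 : q ≠ 2) (hr : 0 < r) (hp : PruneOK p)
    (h : FamOK χ m p r ft) {lam : ℝ} (hlam : ∀ z, ‖p z‖ ≤ lam)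
    (μ : Measure ℚ_[q]) [μ.IsAddHaarMeasure] [SigmaFinite μ] {j a l : ℕ} (hjl : j ≤ l)
    (hl : l < m) :
    ∫ x, (gt q ft j a l x - gp q p ft j a (l + 1) x) ^ 2 ∂(μ.prod μ)
      ≤ (q : ℝ) ^ 3 * lam ^ 2 * ∫ x, gt q ft j a m x ∂(μ.prod μ) := by
  classical
  have hq0 : 0 < q := (Fact.out : q.Prime).pos
  have hq1 : (1 : ℝ) ≤ q := (qgt1 (q := q)).le
  -- pieces
  let hh : ℕ → ℚ_[q] × ℚ_[q] → ℝ := fun c x =>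
    ‖ft l c x‖ ^ 2 - ∑ b ∈ Finset.range q, ‖p (ft (l + 1) (c + b * q ^ l) x)‖ ^ 2
  have hhdef : ∀ c x, hh c x = ‖ft l c x‖ ^ 2
    - ∑ b ∈ Finset.range q, ‖p (ft (l + 1) (c + b * q ^ l) x)‖ ^ 2 := fun _ _ => rfl
  have hhgd : ∀ c, Gd r (hh c) := by
    intro c
    refine ⟨fun x t ht => ?_, fun x hx => ?_⟩
    · simp only [hhdef, (h.gd _ _).1 x t ht]
    · simp [hhdef, (h.gd _ _).2 x hx, hp.zero]
  have hsum : ∀ x, gt q ft j a l x - gp q p ft j a (l + 1) x = ∑ c ∈ DD q l j a, hh c x := by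
    intro x
    unfold gt gp
    rw [DD_sum hq0 hjl, ← Finset.sum_sub_distrib]
  have hexp : ∀ c x, ((hh c x : ℝ) : ℂ) = ∑ b ∈ Finset.range q, ∑ b' ∈ Finset.range q,
      if b = b' then 0 else p (ft (l + 1) (c + b * q ^ l) x)
        * (starRingEnd ℂ) (p (ft (l + 1) (c + b' * q ^ l) x)) := by
    intro c x
    have key : ∀ z : ℂ, ((‖z‖ ^ 2 : ℝ) : ℂ) = z * (starRingEnd ℂ) z := by
      intro z; rw [Complex.mul_conj, Complex.normSq_eq_norm_sq]
    rw [hhdef, Complex.ofReal_sub, Complex.ofReal_sum, key, h.step l hl, map_sum,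
      Finset.sum_mul_sum, ← Finset.sum_sub_distrib]
    apply Finset.sum_congr rfl
    intro b hb
    rw [key, sub_eq_iff_eq_add]
    rw [← Finset.sum_erase_add _ _ hb]
    congr 1
    rw [← Finset.sum_erase_add _ _ hb]
    simp only [if_true, add_zero]
    apply Finset.sum_congr rfl
    intro b' hb'
    rw [if_neg (Finset.ne_of_mem_erase hb').symm]
  have hinv : ∀ c x u, u ∈ UU q l c → hh c (x + u) = hh c x := by
    intro c x u hu
    rw [hhdef, hhdef, (h.qi l hl.le c).norm hχ hu]
    congr 1
    apply Finset.sum_congr rfl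
    intro b _
    have := ((h.qi (l + 1) hl (c + b * q ^ l)).prune hp hχ).mono hχ (Nat.le_succ l)
      (modEq_child q l c b)
    rw [this.norm hχ hu]
  have e1 : ∫ x, (gt q ft j a l x - gp q p ft j a (l + 1) x) ^ 2 ∂(μ.prod μ)
      = ∫ x, ∑ c ∈ DD q l j a, (hh c x) ^ 2 ∂(μ.prod μ) := by
    have := pythag (μ.prod μ) (DD q l j a) (fun c x => ((hh c x : ℝ) : ℂ)) ?_ ?_
    · simp only [← Complex.ofReal_sum, Complex.norm_real, Real.norm_eq_abs, sq_abs] at this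
      simp only [hsum]
      exact this
    · intro c _ c' _
      refine Gd.integrable hr μ ⟨fun x t ht => ?_, fun x hx => ?_⟩
      · simp only [(hhgd _).1 x t ht]
      · simp [(hhgd _).2 x hx]
    · intro c hc c' hc' hne
      have hcc : ¬ c ≡ c' [MOD q ^ l] := fun hm => hne (DD_inj hc hc' hm)
      simp only [Complex.conj_ofReal]
      simp only [hexp c', Finset.mul_sum]
      rw [integral_finsetSum]
      · apply Finset.sum_eq_zero
        intro b hb
        rw [integral_finsetSum]
        · apply Finset.sum_eq_zero
          intro b' hb'
          by_cases hbb : b = b'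
          · simp [hbb]
          · simp only [if_neg hbb]
            refine high_orth hχ hq2 μ (c := c) (c' := c') (d := c' + b * q ^ l)
              (d' := c' + b' * q ^ l) (l := l) ?_ ((h.qi (l + 1) hl _).prune hp hχ)
              ((h.qi (l + 1) hl _).prune hp hχ) (modEq_child _ _ _ _) (modEq_child _ _ _ _)
              (child_ne hq0 (Finset.mem_range.1 hb) (Finset.mem_range.1 hb') hbb) hcc
            intro x u hu
            rw [hinv c x u hu]
        · intro b' _
          refine Gd.integrable hr μ ⟨fun x t ht => ?_, fun x hx => ?_⟩
          · simp only [(hhgd _).1 x t ht, (h.gd _ _).1 x t ht]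
          · simp [(hhgd _).2 x hx]
      · intro b _
        refine Gd.integrable hr μ ⟨fun x t ht => ?_, fun x hx => ?_⟩
        · simp only [(hhgd _).1 x t ht, (h.gd _ _).1 x t ht]
        · simp [(hhgd _).2 x hx]
  rw [e1]
  have hpt : ∀ x, ∑ c ∈ DD q l j a, (hh c x) ^ 2
      ≤ (q : ℝ) ^ 3 * lam ^ 2 * gp q p ft j a (l + 1) x := by
    intro x
    unfold gp
    rw [DD_sum hq0 hjl, Finset.mul_sum]
    apply Finset.sum_le_sum
    intro c _
    obtain ⟨S, hS⟩ : ∃ S, S = ∑ b ∈ Finset.range q, ‖p (ft (l + 1) (c + b * q ^ l) x)‖ ^ 2 :=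
      ⟨_, rfl⟩
    have hS0 : 0 ≤ S := by rw [hS]; positivity
    have h1 : ‖ft l c x‖ ^ 2 ≤ q * S := by
      rw [h.step l hl, hS]
      simpa using sq_sum_le_card (Finset.range q) (fun b => p (ft (l + 1) (c + b * q ^ l) x))
    have h2 : S ≤ q * lam ^ 2 := by
      rw [hS]
      calc _ ≤ ∑ b ∈ Finset.range q, lam ^ 2 := by
            apply Finset.sum_le_sum
            intro b _
            gcongr
            exact hlam _
        _ = _ := by simp
    rw [hhdef, ← hS]
    have h3 : (‖ft l c x‖ ^ 2 - S) ^ 2 ≤ (q * S) ^ 2 := by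
      apply sq_le_sq'
      · nlinarith [sq_nonneg ‖ft l c x‖]
      · nlinarith
    calc _ ≤ (q * S) ^ 2 := h3
      _ = (q : ℝ) ^ 2 * S * S := by ring
      _ ≤ (q : ℝ) ^ 2 * (q * lam ^ 2) * S := by gcongr
      _ = _ := by ring
  calc _ ≤ ∫ x, (q : ℝ) ^ 3 * lam ^ 2 * gp q p ft j a (l + 1) x ∂(μ.prod μ) := by
        apply integral_mono _ _ hpt
        · refine Gd.integrable hr μ ⟨fun x t ht => ?_, fun x hx => ?_⟩
          · simp only [(hhgd _).1 x t ht]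
          · simp [(hhgd _).2 x hx]
        · exact ((gd_gp hp h _ _ _).integrable hr μ).const_mul _
    _ = (q : ℝ) ^ 3 * lam ^ 2 * ∫ x, gt q ft j a l x ∂(μ.prod μ) := by
        rw [integral_const_mul, energy_step hχ hr hp h μ hjl hl]
    _ ≤ _ := by
        exact mul_le_mul_of_nonneg_left (energy_le hχ hr hp h μ hjl hl.le) (by positivity)

/-- the bilinear identity -/
theorem bil_est (hχ : ChiOK χ) (hq2 : q ≠ 2) (hr : 0 < r)
    (h : FamOK χ m p r ft)
    (μ : Measure ℚ_[q]) [μ.IsAddHaarMeasure] [SigmaFinite μ] {j a k t t' : ℕ} (hjk : j < k)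
    (hk : k ≤ m) (ht : t ≡ a [MOD q ^ j]) (ht' : t' ≡ a [MOD q ^ j])
    (htt : ¬ t ≡ t' [MOD q ^ (j + 1)]) (w : ℚ_[q] × ℚ_[q] → ℂ)
    (hw : ∀ x u, u ∈ TT q k j a → w (x + u) = w x)
    (hwr : ∀ x u, ‖u‖ ≤ r → w (x + u) = w x) :
    ∫ x, ‖w x‖ ^ 2 * (‖∑ c ∈ DD q k (j + 1) t, ft k c x‖ ^ 2
        * ‖∑ c ∈ DD q k (j + 1) t', ft k c x‖ ^ 2) ∂(μ.prod μ)
      = ∫ x, ‖w x‖ ^ 2 * (gt q ft (j + 1) t k x * gt q ft (j + 1) t' k x) ∂(μ.prod μ) := by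
  have := pythag (μ.prod μ) (DD q k (j + 1) t ×ˢ DD q k (j + 1) t')
    (fun i x => w x * (ft k i.1 x * ft k i.2 x)) ?_ ?_
  · convert this using 3 with x x
    · rw [← Finset.mul_sum, Finset.sum_product]
      simp only [← Finset.mul_sum]
      rw [← Finset.sum_mul, norm_mul, norm_mul]
      ring
    · unfold gt
      rw [Finset.sum_mul_sum, Finset.sum_product, Finset.mul_sum]
      apply Finset.sum_congr rfl
      intro c _
      rw [Finset.mul_sum]
      apply Finset.sum_congr rfl
      intro c' _
      rw [norm_mul, norm_mul]
      ring
  · intro i _ i' _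
    refine Gd.integrable hr μ ⟨fun x t ht => ?_, fun x hx => ?_⟩
    · simp only [hwr x t ht, (h.gd _ _).1 x t ht]
    · simp [(h.gd _ _).2 x hx]
  · rintro ⟨c₁, c₃⟩ h1 ⟨c₂, c₄⟩ h2 hne
    simp only [Finset.mem_product] at h1 h2
    refine bil_orth hχ hq2 μ (a := a) (t := t) (t' := t') hjk hw (h.qi k hk c₁) (h.qi k hk c₂)
      (h.qi k hk c₃) (h.qi k hk c₄) ht ht' htt (mem_DD.1 h1.1).2 (mem_DD.1 h2.1).2
      (mem_DD.1 h1.2).2 (mem_DD.1 h2.2).2 ?_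
    rintro ⟨e1, e2⟩
    apply hne
    rw [DD_inj h1.1 h2.1 e1, DD_inj h1.2 h2.2 e2]

end Node

section NodeProp

variable {q : ℕ} [Fact q.Prime] {χ : ℚ_[q] → ℂ} {m : ℕ} {p : ℂ → ℂ} {r : ℝ}
  {ft : ℕ → ℕ → ℚ_[q] × ℚ_[q] → ℂ}

theorem kappa_pow_le {m n : ℕ} (hm : 1 ≤ m) (hn : n ≤ m) : (1 + 1 / (m : ℝ)) ^ n ≤ 3 := by
  have hm0 : (0 : ℝ) < m := by exact_mod_cast hm
  have h1 : (1 : ℝ) ≤ 1 + 1 / (m : ℝ) := by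
    have : 0 ≤ 1 / (m : ℝ) := by positivity
    linarith
  calc (1 + 1 / (m : ℝ)) ^ n ≤ (1 + 1 / (m : ℝ)) ^ m := pow_le_pow_right₀ h1 hn
    _ ≤ (Real.exp (1 / (m : ℝ))) ^ m := by
        gcongr
        rw [add_comm]; exact Real.add_one_le_exp _
    _ = Real.exp 1 := by
        rw [← Real.exp_nat_mul]; congr 1; field_simp
    _ ≤ 3 := by linarith [Real.exp_one_lt_d9]

theorem prune_ok {lam : ℝ} : PruneOK (fun z : ℂ => if ‖z‖ ≤ lam then z else 0) := by
  refine ⟨by simp, ?_, ?_⟩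
  · intro z
    split_ifs <;> simp
  · intro w z hw
    simp only [norm_mul, hw, one_mul]
    split_ifs <;> simp

theorem prune_le {lam : ℝ} (hl : 0 ≤ lam) (z : ℂ) :
    ‖(if ‖z‖ ≤ lam then z else 0)‖ ≤ lam := by
  split_ifs with h
  · exact h
  · simpa using hl

theorem prune_err {lam : ℝ} (hl : 0 < lam) (z : ℂ) :
    ‖z - (if ‖z‖ ≤ lam then z else 0)‖ ≤ ‖z‖ ^ 2 / lam := by
  split_ifs with h
  · simp; positivity
  · push Not at h
    rw [sub_zero, le_div_iff₀ hl]
    nlinarith [norm_nonneg z]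

theorem gt_bound (hm : 1 ≤ m) {j a k : ℕ} {A : ℝ} (hA : 0 ≤ A) {x : ℚ_[q] × ℚ_[q]}
    (hx : gt q ft j a m x ≤ A)
    (hk : ∀ l, k < l → l < m → gt q ft j a l x ≤ (1 + 1 / (m : ℝ)) * gt q ft j a (l + 1) x) :
    ∀ l, k < l → l ≤ m → gt q ft j a l x ≤ 3 * A := by
  have hκ : (0 : ℝ) ≤ 1 + 1 / (m : ℝ) := by positivity
  have H : ∀ n l, l + n = m → k < l → gt q ft j a l x ≤ (1 + 1 / (m : ℝ)) ^ n * A := by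
    intro n
    induction n with
    | zero => intro l hl _; simp at hl; subst hl; simpa using hx
    | succ n ih =>
      intro l hl hkl
      calc _ ≤ (1 + 1 / (m : ℝ)) * gt q ft j a (l + 1) x := hk l hkl (by omega)
        _ ≤ (1 + 1 / (m : ℝ)) * ((1 + 1 / (m : ℝ)) ^ n * A) := by
            gcongr
            exact ih (l + 1) (by omega) (by omega)
        _ = _ := by ring
  intro l hkl hlm
  calc _ ≤ _ := H (m - l) l (by omega) hkl
    _ ≤ 3 * A := by
      gcongr
      exact kappa_pow_le hm (by omega)

theorem telescope (h : FamOK χ m p r ft) {lam G : ℝ} (hlam : 0 < lam)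
    (hperr : ∀ z, ‖z - p z‖ ≤ ‖z‖ ^ 2 / lam) {j a t k : ℕ} (ht : t ≡ a [MOD q ^ j])
    (hjk : j + 1 ≤ k) (hk : k ≤ m) {x : ℚ_[q] × ℚ_[q]}
    (hG : ∀ l, k < l → l ≤ m → gt q ft j a l x ≤ G) :
    ‖∑ c ∈ DD q m (j + 1) t, ft m c x - ∑ c ∈ DD q k (j + 1) t, ft k c x‖
      ≤ (m - k : ℕ) * (G / lam) := by
  have hq0 : 0 < q := (Fact.out : q.Prime).pos
  obtain ⟨n, hn⟩ : ∃ n, n = m - k := ⟨_, rfl⟩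
  rw [← hn]
  induction n generalizing k with
  | zero =>
    have : m = k := by omega
    subst this
    simp
  | succ n ih =>
    have h1 := ih (k := k + 1) (by omega) (by omega) (fun l hl hl' => hG l (by omega) hl')
      (by omega)
    have h2 : ∑ c ∈ DD q k (j + 1) t, ft k c x
        = ∑ c ∈ DD q (k + 1) (j + 1) t, p (ft (k + 1) c x) := by
      rw [DD_sum hq0 hjk]
      exact Finset.sum_congr rfl fun c _ => h.step k (by omega) c x
    have h3 : ‖∑ c ∈ DD q (k + 1) (j + 1) t, ft (k + 1) c x
        - ∑ c ∈ DD q k (j + 1) t, ft k c x‖ ≤ G / lam := by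
      rw [h2, ← Finset.sum_sub_distrib]
      calc _ ≤ ∑ c ∈ DD q (k + 1) (j + 1) t, ‖ft (k + 1) c x - p (ft (k + 1) c x)‖ :=
            norm_sum_le _ _
        _ ≤ ∑ c ∈ DD q (k + 1) (j + 1) t, ‖ft (k + 1) c x‖ ^ 2 / lam :=
            Finset.sum_le_sum fun c _ => hperr _
        _ ≤ ∑ c ∈ DD q (k + 1) j a, ‖ft (k + 1) c x‖ ^ 2 / lam :=
            Finset.sum_le_sum_of_subset_of_nonneg (DD_sub ht) (fun _ _ _ => by positivity)
        _ = gt q ft j a (k + 1) x / lam := by rw [← Finset.sum_div]; rfl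
        _ ≤ G / lam := by
            gcongr
            exact hG _ (by omega) (by omega)
    calc _ ≤ _ := norm_sub_le_norm_sub_add_norm_sub _
              (∑ c ∈ DD q (k + 1) (j + 1) t, ft (k + 1) c x) _
      _ ≤ n * (G / lam) + G / lam := add_le_add h1 h3
      _ = _ := by push_cast; ring

/-- first high-dominated scale -/
def Om (q : ℕ) [Fact q.Prime] (ft : ℕ → ℕ → ℚ_[q] × ℚ_[q] → ℂ) (m j a k : ℕ)
    (x : ℚ_[q] × ℚ_[q]) : Prop :=
  (1 + 1 / (m : ℝ)) * gt q ft j a (k + 1) x < gt q ft j a k x ∧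
  ∀ l, k < l → l < m → gt q ft j a l x ≤ (1 + 1 / (m : ℝ)) * gt q ft j a (l + 1) x

theorem gt_TT (hχ : ChiOK χ) (h : FamOK χ m p r ft) {j a k l : ℕ} (hjk : j ≤ k) (hkl : k ≤ l)
    (hl : l ≤ m) {x u} (hu : u ∈ TT q k j a) : gt q ft j a l (x + u) = gt q ft j a l x := by
  unfold gt
  apply Finset.sum_congr rfl
  intro c hc
  rw [(h.qi l hl c).norm hχ (TT_sub_UU hkl hjk (mem_DD.1 hc).2 hu)]

theorem Om_TT (hχ : ChiOK χ) (h : FamOK χ m p r ft) {j a k : ℕ} (hjk : j ≤ k) (hk : k < m)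
    {x u} (hu : u ∈ TT q k j a) : Om q ft m j a k (x + u) = Om q ft m j a k x := by
  unfold Om
  rw [gt_TT hχ h hjk (Nat.le_succ k) hk hu, gt_TT hχ h hjk le_rfl hk.le hu]
  congr 1
  apply propext
  refine forall_congr' fun l => forall_congr' fun h1 => forall_congr' fun h2 => ?_
  rw [gt_TT hχ h hjk h1.le h2.le hu, gt_TT hχ h hjk (by omega) (by omega) hu]

theorem Om_r (h : FamOK χ m p r ft) {j a k : ℕ}
    {x u} (hu : ‖u‖ ≤ r) : Om q ft m j a k (x + u) = Om q ft m j a k x := by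
  unfold Om
  simp only [(gd_gt h _ _ _).1 x u hu]

open Classical in
theorem om_est (hχ : ChiOK χ) (hq2 : q ≠ 2) (hm : 1 ≤ m) (hr : 0 < r) (hp : PruneOK p)
    (h : FamOK χ m p r ft) {lam : ℝ} (hlam : ∀ z, ‖p z‖ ≤ lam)
    (μ : Measure ℚ_[q]) [μ.IsAddHaarMeasure] [SigmaFinite μ] {j a k t t' : ℕ} (hjk : j < k)
    (hk : k < m) (ht : t ≡ a [MOD q ^ j]) (ht' : t' ≡ a [MOD q ^ j])
    (htt : ¬ t ≡ t' [MOD q ^ (j + 1)]) :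
    ∫ x, ‖(if Om q ft m j a k x then 1 else 0 : ℂ)‖ ^ 2
      * (‖∑ c ∈ DD q k (j + 1) t, ft k c x‖ ^ 2
        * ‖∑ c ∈ DD q k (j + 1) t', ft k c x‖ ^ 2) ∂(μ.prod μ)
      ≤ 4 * (m : ℝ) ^ 2 * ((q : ℝ) ^ 3 * lam ^ 2 * ∫ x, gt q ft j a m x ∂(μ.prod μ)) := by
  rw [bil_est hχ hq2 hr h μ hjk hk.le ht ht' htt]
  rotate_left
  · intro x u hu
    simp only [Om_TT hχ h hjk.le hk hu]
  · intro x u hu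
    simp only [Om_r h hu]
  have hm0 : (0 : ℝ) < m := by exact_mod_cast hm
  have hm1 : (1 : ℝ) ≤ m := by exact_mod_cast hm
  have hpt : ∀ x, ‖(if Om q ft m j a k x then 1 else 0 : ℂ)‖ ^ 2
      * (gt q ft (j + 1) t k x * gt q ft (j + 1) t' k x)
      ≤ 4 * (m : ℝ) ^ 2 * (gt q ft j a k x - gp q p ft j a (k + 1) x) ^ 2 := by
    intro x
    split_ifs with hO
    · have h1 : gt q ft (j + 1) t k x ≤ gt q ft j a k x :=
        Finset.sum_le_sum_of_subset_of_nonneg (DD_sub ht) (fun _ _ _ => by positivity)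
      have h2 : gt q ft (j + 1) t' k x ≤ gt q ft j a k x :=
        Finset.sum_le_sum_of_subset_of_nonneg (DD_sub ht') (fun _ _ _ => by positivity)
      have h3 := hO.1
      have h4 := gp_le_gt (ft := ft) hp j a (k + 1) x
      have g1 := gt_nonneg (ft := ft) (j + 1) t k x
      have g2 := gt_nonneg (ft := ft) (j + 1) t' k x
      have g3 := gt_nonneg (ft := ft) j a k x
      have g4 := gt_nonneg (ft := ft) j a (k + 1) x
      have h5 : gt q ft j a k x ≤ 2 * m * (gt q ft j a k x - gp q p ft j a (k + 1) x) := by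
        have e : (1 + 1 / (m : ℝ)) * m = m + 1 := by field_simp
        have h6 : ((m : ℝ) + 1) * gt q ft j a (k + 1) x ≤ m * gt q ft j a k x := by
          have := mul_le_mul_of_nonneg_left h3.le hm0.le
          calc _ = (m : ℝ) * ((1 + 1 / (m : ℝ)) * gt q ft j a (k + 1) x) := by rw [← e]; ring
            _ ≤ _ := this
        have h7 : ((m : ℝ) + 1) * gp q p ft j a (k + 1) x
          ≤ ((m : ℝ) + 1) * gt q ft j a (k + 1) x := by gcongr
        have h8 : gp q p ft j a (k + 1) x ≤ gt q ft j a k x := by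
          have : (1 : ℝ) ≤ 1 + 1 / (m : ℝ) := by
            have : 0 ≤ 1 / (m : ℝ) := by positivity
            linarith
          nlinarith
        nlinarith
      calc ‖(1 : ℂ)‖ ^ 2 * (gt q ft (j + 1) t k x * gt q ft (j + 1) t' k x)
          ≤ gt q ft j a k x * gt q ft j a k x := by
            simp only [norm_one, one_pow, one_mul]
            gcongr
        _ ≤ (2 * m * (gt q ft j a k x - gp q p ft j a (k + 1) x))
            * (2 * m * (gt q ft j a k x - gp q p ft j a (k + 1) x)) := by
            exact mul_le_mul h5 h5 g3 (g3.trans h5)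
        _ = _ := by ring
    · simp; positivity
  calc _ ≤ ∫ x, 4 * (m : ℝ) ^ 2 * (gt q ft j a k x - gp q p ft j a (k + 1) x) ^ 2
          ∂(μ.prod μ) := by
        apply integral_mono _ _ hpt
        · refine Gd.integrable hr μ ⟨fun x t ht => ?_, fun x hx => ?_⟩
          · simp only [Om_r h ht, (gd_gt h _ _ _).1 x t ht]
          · simp [(gd_gt h _ _ _).2 x hx]
        · refine Gd.integrable hr μ ⟨fun x t ht => ?_, fun x hx => ?_⟩
          · simp only [(gd_gp hp h _ _ _).1 x t ht, (gd_gt h _ _ _).1 x t ht]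
          · simp [(gd_gt h _ _ _).2 x hx, (gd_gp hp h _ _ _).2 x hx]
    _ ≤ _ := by
        rw [integral_const_mul]
        exact mul_le_mul_of_nonneg_left (high_est hχ hq2 hr hp h hlam μ hjk.le hk) (by positivity)

open Classical in
theorem node_est (hχ : ChiOK χ) (hq2 : q ≠ 2) (hm : 1 ≤ m) (hr : 0 < r)
    (μ : Measure ℚ_[q]) [μ.IsAddHaarMeasure] [SigmaFinite μ]
    (F : ℕ → ℚ_[q] × ℚ_[q] → ℂ) (hF : ∀ c, QI χ m c (F c)) (hg : ∀ c, Gd r (F c))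
    {A : ℝ} (hA : 0 < A) {j a t t' : ℕ} (hj : j < m)
    (hFA : ∀ x, ∑ c ∈ DD q m j a, ‖F c x‖ ^ 2 ≤ A)
    (ht : t ≡ a [MOD q ^ j]) (ht' : t' ≡ a [MOD q ^ j])
    (htt : ¬ t ≡ t' [MOD q ^ (j + 1)])
    (htl : t < q ^ (j + 1)) (htl' : t' < q ^ (j + 1))
    {α₁ α₂ : ℝ} (hα₂ : 0 < α₂) (hα : α₂ ≤ α₁) :
    α₁ ^ 2 * α₂ ^ 4 * ∫ x, (if α₁ ≤ ‖∑ c ∈ DD q m (j + 1) t, F c x‖ ∧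
        α₂ ≤ ‖∑ c ∈ DD q m (j + 1) t', F c x‖ then (1 : ℝ) else 0) ∂(μ.prod μ)
      ≤ 2880 * (q : ℝ) ^ 3 * (m : ℝ) ^ 5 * A ^ 2
        * ∫ x, ∑ c ∈ DD q m j a, ‖F c x‖ ^ 2 ∂(μ.prod μ) := by
  have hm0 : (0 : ℝ) < m := by exact_mod_cast hm
  have hm1 : (1 : ℝ) ≤ m := by exact_mod_cast hm
  obtain ⟨lam, hlamdef⟩ : ∃ lam : ℝ, lam = 6 * m * A / α₂ := ⟨_, rfl⟩
  have hlam : 0 < lam := by rw [hlamdef]; positivity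
  obtain ⟨ft, h, hftm⟩ := fam_exists (prune_ok (lam := lam)) hχ F hF hg
  have hple : ∀ z, ‖(fun z : ℂ => if ‖z‖ ≤ lam then z else 0) z‖ ≤ lam := prune_le hlam.le
  have hperr : ∀ z, ‖z - (fun z : ℂ => if ‖z‖ ≤ lam then z else 0) z‖ ≤ ‖z‖ ^ 2 / lam :=
    prune_err hlam
  have hp := prune_ok (lam := lam)
  generalize (fun z : ℂ => if ‖z‖ ≤ lam then z else 0) = p at h hple hperr hp
  subst hftm
  have hα₁ : 0 < α₁ := hα₂.trans_le hα
  have hq1 : (1 : ℝ) ≤ q := (qgt1 (q := q)).le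
  have hself : ∀ s, s < q ^ (j + 1) → DD q (j + 1) (j + 1) s = {s} := by
    intro s hs
    ext c
    rw [mem_DD, Finset.mem_singleton]
    constructor
    · rintro ⟨h1, h2⟩; exact Nat.ModEq.eq_of_lt_of_lt h2 h1 hs
    · rintro rfl; exact ⟨hs, rfl⟩
  have hpt : ∀ x, α₁ ^ 2 * α₂ ^ 4 * (if α₁ ≤ ‖∑ c ∈ DD q m (j + 1) t, ft m c x‖ ∧
        α₂ ≤ ‖∑ c ∈ DD q m (j + 1) t', ft m c x‖ then (1 : ℝ) else 0)
      ≤ ∑ k ∈ Finset.Ico (j + 1) m, 16 * α₂ ^ 2 *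
          (‖(if Om q ft m j a k x then 1 else 0 : ℂ)‖ ^ 2
      * (‖∑ c ∈ DD q k (j + 1) t, ft k c x‖ ^ 2
        * ‖∑ c ∈ DD q k (j + 1) t', ft k c x‖ ^ 2)) + 576 * A ^ 2 * gt q ft j a (j + 1) x := by
    intro x
    have hg0 := gt_nonneg (ft := ft) j a (j + 1) x
    split_ifs with hW
    swap
    · rw [mul_zero]
      positivity
    obtain ⟨hW1, hW2⟩ := hW
    have key : ∀ k, j ≤ k → k < m → (∀ l, k < l → l < m →
        gt q ft j a l x ≤ (1 + 1 / (m : ℝ)) * gt q ft j a (l + 1) x) →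
        ∀ k', k ≤ k' → j + 1 ≤ k' → k' ≤ m → ∀ s, s ≡ a [MOD q ^ j] →
        ‖∑ c ∈ DD q m (j + 1) s, ft m c x - ∑ c ∈ DD q k' (j + 1) s, ft k' c x‖ ≤ α₂ / 2 := by
      intro k hjk hkm hk k' hkk hjk' hk' s hs
      have hb := gt_bound (ft := ft) (j := j) (a := a) hm hA.le (hFA x) hk
      have := telescope h hlam hperr hs hjk' hk' (G := 3 * A) (x := x)
        (fun l hl hl' => hb l (by omega) hl')
      refine this.trans ?_
      have e : α₂ / 2 = m * (3 * A / lam) := by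
        rw [hlamdef]; field_simp; norm_num
      rw [e]
      gcongr
      omega
    by_cases hex : ∃ k ∈ Finset.Ico (j + 1) m,
        (1 + 1 / (m : ℝ)) * gt q ft j a (k + 1) x < gt q ft j a k x
    · obtain ⟨k, hk1, hk2⟩ := Finset.exists_max_image ((Finset.Ico (j + 1) m).filter
        (fun k => (1 + 1 / (m : ℝ)) * gt q ft j a (k + 1) x < gt q ft j a k x)) id (by
          obtain ⟨k, hk, hk'⟩ := hex
          exact ⟨k, Finset.mem_filter.2 ⟨hk, hk'⟩⟩)
      rw [Finset.mem_filter, Finset.mem_Ico] at hk1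
      obtain ⟨⟨hk3, hk4⟩, hk5⟩ := hk1
      have hrest : ∀ l, k < l → l < m →
          gt q ft j a l x ≤ (1 + 1 / (m : ℝ)) * gt q ft j a (l + 1) x := by
        intro l hl hlm
        by_contra hc
        have := hk2 l (Finset.mem_filter.2 ⟨Finset.mem_Ico.2 ⟨by omega, hlm⟩, not_le.1 hc⟩)
        simp at this
        omega
      have hOm : Om q ft m j a k x := ⟨hk5, hrest⟩
      have k1 := key k (by omega) hk4 hrest k le_rfl hk3 hk4.le t ht
      have k2 := key k (by omega) hk4 hrest k le_rfl hk3 hk4.le t' ht'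
      have n1 : α₁ / 2 ≤ ‖∑ c ∈ DD q k (j + 1) t, ft k c x‖ := by
        have := norm_sub_norm_le (∑ c ∈ DD q m (j + 1) t, ft m c x)
          (∑ c ∈ DD q k (j + 1) t, ft k c x)
        linarith
      have n2 : α₂ / 2 ≤ ‖∑ c ∈ DD q k (j + 1) t', ft k c x‖ := by
        have := norm_sub_norm_le (∑ c ∈ DD q m (j + 1) t', ft m c x)
          (∑ c ∈ DD q k (j + 1) t', ft k c x)
        linarith
      have := Finset.single_le_sum (f := fun k => 16 * α₂ ^ 2 *
          (‖(if Om q ft m j a k x then 1 else 0 : ℂ)‖ ^ 2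
      * (‖∑ c ∈ DD q k (j + 1) t, ft k c x‖ ^ 2
        * ‖∑ c ∈ DD q k (j + 1) t', ft k c x‖ ^ 2))) (fun i _ => by positivity)
        (Finset.mem_Ico.2 ⟨hk3, hk4⟩)
      simp only [if_pos hOm, norm_one, one_pow, one_mul] at this
      have h2 : 16 * α₂ ^ 2 * ((α₁ / 2) ^ 2 * (α₂ / 2) ^ 2) ≤ 16 * α₂ ^ 2 *
        (‖∑ c ∈ DD q k (j + 1) t, ft k c x‖ ^ 2
        * ‖∑ c ∈ DD q k (j + 1) t', ft k c x‖ ^ 2) := by gcongr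
      have h3 : 0 ≤ 576 * A ^ 2 * gt q ft j a (j + 1) x := by positivity
      calc α₁ ^ 2 * α₂ ^ 4 * 1 = 16 * α₂ ^ 2 * ((α₁ / 2) ^ 2 * (α₂ / 2) ^ 2) := by ring
        _ ≤ _ := h2
        _ ≤ _ := this
        _ ≤ _ := by linarith
    · push Not at hex
      have hrest : ∀ l, j < l → l < m →
          gt q ft j a l x ≤ (1 + 1 / (m : ℝ)) * gt q ft j a (l + 1) x := fun l hl hlm =>
        hex l (Finset.mem_Ico.2 ⟨hl, hlm⟩)
      have hb := gt_bound (ft := ft) (j := j) (a := a) hm hA.le (hFA x) hrest (j + 1)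
        (by omega) hj
      have k1 := key j le_rfl hj hrest (j + 1) (by omega) le_rfl hj t ht
      have k2 := key j le_rfl hj hrest (j + 1) (by omega) le_rfl hj t' ht'
      have n1 : α₁ / 2 ≤ ‖∑ c ∈ DD q (j + 1) (j + 1) t, ft (j + 1) c x‖ := by
        have := norm_sub_norm_le (∑ c ∈ DD q m (j + 1) t, ft m c x)
          (∑ c ∈ DD q (j + 1) (j + 1) t, ft (j + 1) c x)
        linarith
      have n2 : α₂ / 2 ≤ ‖∑ c ∈ DD q (j + 1) (j + 1) t', ft (j + 1) c x‖ := by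
        have := norm_sub_norm_le (∑ c ∈ DD q m (j + 1) t', ft m c x)
          (∑ c ∈ DD q (j + 1) (j + 1) t', ft (j + 1) c x)
        linarith
      rw [hself t htl, Finset.sum_singleton] at n1
      rw [hself t' htl', Finset.sum_singleton] at n2
      have hle : ∀ s, s < q ^ (j + 1) → s ≡ a [MOD q ^ j] →
          ‖ft (j + 1) s x‖ ^ 2 ≤ gt q ft j a (j + 1) x := by
        intro s hs hs'
        exact Finset.single_le_sum (f := fun c => ‖ft (j + 1) c x‖ ^ 2)
          (fun _ _ => by positivity) (mem_DD.2 ⟨hs, hs'⟩)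
      have l1 : (α₁ / 2) ^ 2 ≤ gt q ft j a (j + 1) x :=
        le_trans (by gcongr) (hle t htl ht)
      have l2 : (α₂ / 2) ^ 2 ≤ gt q ft j a (j + 1) x :=
        le_trans (by gcongr) (hle t' htl' ht')
      have l3 : (0 : ℝ) ≤ ∑ k ∈ Finset.Ico (j + 1) m, 16 * α₂ ^ 2 *
          (‖(if Om q ft m j a k x then 1 else 0 : ℂ)‖ ^ 2
      * (‖∑ c ∈ DD q k (j + 1) t, ft k c x‖ ^ 2
        * ‖∑ c ∈ DD q k (j + 1) t', ft k c x‖ ^ 2)) :=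
        Finset.sum_nonneg fun _ _ => by positivity
      calc α₁ ^ 2 * α₂ ^ 4 * 1 = 64 * ((α₁ / 2) ^ 2 * (α₂ / 2) ^ 2 * (α₂ / 2) ^ 2) := by ring
        _ ≤ 64 * ((3 * A) * (3 * A) * gt q ft j a (j + 1) x) := by
          have b1 := l1.trans hb
          have b2 := l2.trans hb
          gcongr
        _ = 576 * A ^ 2 * gt q ft j a (j + 1) x := by ring
        _ ≤ _ := by linarith
  have hgB : ∫ x, gt q ft j a (j + 1) x ∂(μ.prod μ) ≤ ∫ x, gt q ft j a m x ∂(μ.prod μ) :=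
    energy_le hχ hr hp h μ (by omega) hj
  have hB0 : 0 ≤ ∫ x, gt q ft j a m x ∂(μ.prod μ) := integral_nonneg fun x => gt_nonneg _ _ _ _
  have hInt0 : ∀ k, Gd r (fun x => 16 * α₂ ^ 2 *
          (‖(if Om q ft m j a k x then 1 else 0 : ℂ)‖ ^ 2
      * (‖∑ c ∈ DD q k (j + 1) t, ft k c x‖ ^ 2
        * ‖∑ c ∈ DD q k (j + 1) t', ft k c x‖ ^ 2))) := by
    intro k
    refine ⟨fun x t ht => ?_, fun x hx => ?_⟩
    · simp only [Om_r h ht, (h.gd _ _).1 x t ht]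
    · simp [(h.gd _ _).2 x hx]
  have hintW : Gd r (fun x => α₁ ^ 2 * α₂ ^ 4 *
      (if α₁ ≤ ‖∑ c ∈ DD q m (j + 1) t, ft m c x‖ ∧
        α₂ ≤ ‖∑ c ∈ DD q m (j + 1) t', ft m c x‖ then (1 : ℝ) else 0)) := by
    refine ⟨fun x t ht => ?_, fun x hx => ?_⟩
    · simp only [(h.gd _ _).1 x t ht]
    · simp only [(h.gd _ _).2 x hx, Finset.sum_const_zero, norm_zero]
      rw [if_neg (by intro hc; linarith [hc.1]), mul_zero]
  have hints : Integrable (fun x => ∑ k ∈ Finset.Ico (j + 1) m, 16 * α₂ ^ 2 *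
          (‖(if Om q ft m j a k x then 1 else 0 : ℂ)‖ ^ 2
      * (‖∑ c ∈ DD q k (j + 1) t, ft k c x‖ ^ 2
        * ‖∑ c ∈ DD q k (j + 1) t', ft k c x‖ ^ 2))) (μ.prod μ) :=
    integrable_finsetSum _ fun k _ => (hInt0 k).integrable hr μ
  have hintg : Integrable (fun x => 576 * A ^ 2 * gt q ft j a (j + 1) x) (μ.prod μ) :=
    ((gd_gt h _ _ _).integrable hr μ).const_mul _
  rw [← integral_const_mul]
  refine (integral_mono (hintW.integrable hr μ) (hints.add hintg) hpt).trans ?_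
  simp only [Pi.add_apply]
  rw [integral_add hints hintg, integral_finsetSum _ (fun k _ => (hInt0 k).integrable hr μ),
    integral_const_mul]
  change _ ≤ 2880 * (q : ℝ) ^ 3 * (m : ℝ) ^ 5 * A ^ 2 * ∫ x, gt q ft j a m x ∂(μ.prod μ)
  have hsum : ∑ k ∈ Finset.Ico (j + 1) m, ∫ x, 16 * α₂ ^ 2 *
          (‖(if Om q ft m j a k x then 1 else 0 : ℂ)‖ ^ 2
      * (‖∑ c ∈ DD q k (j + 1) t, ft k c x‖ ^ 2
        * ‖∑ c ∈ DD q k (j + 1) t', ft k c x‖ ^ 2)) ∂(μ.prod μ)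
      ≤ m * (16 * α₂ ^ 2 * (4 * (m : ℝ) ^ 2 * ((q : ℝ) ^ 3 * lam ^ 2 *
        ∫ x, gt q ft j a m x ∂(μ.prod μ)))) := by
    calc _ ≤ ∑ k ∈ Finset.Ico (j + 1) m, (16 * α₂ ^ 2 * (4 * (m : ℝ) ^ 2 * ((q : ℝ) ^ 3 * lam ^ 2 *
        ∫ x, gt q ft j a m x ∂(μ.prod μ)))) := by
          apply Finset.sum_le_sum
          intro k hk
          rw [Finset.mem_Ico] at hk
          rw [integral_const_mul]
          exact mul_le_mul_of_nonneg_left (om_est hχ hq2 hm hr hp h hple μ (by omega) hk.2 ht ht'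
            htt) (by positivity)
      _ ≤ _ := by
          rw [Finset.sum_const, nsmul_eq_mul]
          gcongr
          simp
  have e : m * (16 * α₂ ^ 2 * (4 * (m : ℝ) ^ 2 * ((q : ℝ) ^ 3 * lam ^ 2 *
        ∫ x, gt q ft j a m x ∂(μ.prod μ))))
      = 2304 * (q : ℝ) ^ 3 * (m : ℝ) ^ 5 * A ^ 2 * ∫ x, gt q ft j a m x ∂(μ.prod μ) := by
    rw [hlamdef]; field_simp; ring
  have hq3 : (1 : ℝ) ≤ (q : ℝ) ^ 3 * (m : ℝ) ^ 5 :=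
    one_le_mul_of_one_le_of_one_le (one_le_pow₀ hq1) (one_le_pow₀ hm1)
  have h5 : 576 * A ^ 2 * ∫ x, gt q ft j a (j + 1) x ∂(μ.prod μ)
      ≤ 576 * A ^ 2 * ((q : ℝ) ^ 3 * (m : ℝ) ^ 5 * ∫ x, gt q ft j a m x ∂(μ.prod μ)) := by
    gcongr
    exact hgB.trans (le_mul_of_one_le_left hB0 hq3)
  rw [e] at hsum
  linarith

end NodeProp

section Assembly

theorem bn {q m : ℕ} (hq : 0 < q) (hm : 1 ≤ m) (z : ℕ → ℕ → ℂ)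
    (hz : ∀ l < m, ∀ c, z l c = ∑ b ∈ Finset.range q, z (l + 1) (c + b * q ^ l)) :
    ∀ t ≤ m, (∃ c < q ^ t, ‖z 0 0‖ ≤ (1 + 1 / (m : ℝ)) ^ t * ‖z t c‖) ∨
      ∃ j < t, ∃ a < q ^ j, ∃ b < q, ∃ b' < q, b ≠ b' ∧
        ‖z 0 0‖ ≤ 3 * q * ‖z (j + 1) (a + b * q ^ j)‖ ∧
        ‖z 0 0‖ ≤ 3 * q ^ 2 * m * ‖z (j + 1) (a + b' * q ^ j)‖ := by
  have hm0 : (0 : ℝ) < m := by exact_mod_cast hm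
  have hq0 : (0 : ℝ) < q := by exact_mod_cast hq
  intro t
  induction t with
  | zero => intro _; left; exact ⟨0, by simp, by simp⟩
  | succ t ih =>
    intro ht
    rcases ih (by omega) with ⟨c, hc, hzc⟩ | ⟨j, hj, h⟩
    swap
    · right; exact ⟨j, by omega, h⟩
    obtain ⟨b, hb, hmax⟩ := Finset.exists_max_image (Finset.range q)
      (fun b => ‖z (t + 1) (c + b * q ^ t)‖) ⟨0, by simpa using hq⟩
    rw [Finset.mem_range] at hb
    have hk3 := kappa_pow_le hm (show t ≤ m by omega)
    have hstep := hz t (by omega) c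
    by_cases hbr : ∃ b' < q, b' ≠ b ∧ ‖z (t + 1) (c + b * q ^ t)‖ / (q * m)
        < ‖z (t + 1) (c + b' * q ^ t)‖
    · right
      obtain ⟨b', hb', hne, hlt⟩ := hbr
      have h1 : ‖z t c‖ ≤ q * ‖z (t + 1) (c + b * q ^ t)‖ := by
        rw [hstep]
        calc _ ≤ ∑ b' ∈ Finset.range q, ‖z (t + 1) (c + b' * q ^ t)‖ := norm_sum_le _ _
          _ ≤ ∑ b' ∈ Finset.range q, ‖z (t + 1) (c + b * q ^ t)‖ := Finset.sum_le_sum hmax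
          _ = _ := by simp
      have h2 : ‖z 0 0‖ ≤ 3 * q * ‖z (t + 1) (c + b * q ^ t)‖ := by
        calc _ ≤ _ := hzc
          _ ≤ 3 * (q * ‖z (t + 1) (c + b * q ^ t)‖) := by gcongr
          _ = _ := by ring
      refine ⟨t, by omega, c, hc, b, hb, b', hb', hne.symm, h2, h2.trans ?_⟩
      rw [div_lt_iff₀ (by positivity)] at hlt
      calc _ ≤ 3 * q * (‖z (t + 1) (c + b' * q ^ t)‖ * (q * m)) := by gcongr
        _ = _ := by ring
    · left
      push Not at hbr
      refine ⟨c + b * q ^ t, ?_, ?_⟩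
      · calc c + b * q ^ t < q ^ t + b * q ^ t := by omega
          _ = (b + 1) * q ^ t := by ring
          _ ≤ q * q ^ t := Nat.mul_le_mul_right _ hb
          _ = q ^ (t + 1) := by ring
      · have h1 : ‖z t c‖ ≤ (1 + 1 / (m : ℝ)) * ‖z (t + 1) (c + b * q ^ t)‖ := by
          rw [hstep, ← Finset.add_sum_erase _ _ (Finset.mem_range.2 hb)]
          calc _ ≤ ‖z (t + 1) (c + b * q ^ t)‖
                + ∑ b' ∈ (Finset.range q).erase b, ‖z (t + 1) (c + b' * q ^ t)‖ :=
                (norm_add_le _ _).trans (by gcongr; exact norm_sum_le _ _)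
            _ ≤ ‖z (t + 1) (c + b * q ^ t)‖
                + ∑ b' ∈ (Finset.range q).erase b, ‖z (t + 1) (c + b * q ^ t)‖ / (q * m) := by
                gcongr with b' hb'
                rw [Finset.mem_erase, Finset.mem_range] at hb'
                exact hbr b' hb'.2 hb'.1
            _ ≤ ‖z (t + 1) (c + b * q ^ t)‖
                + ∑ b' ∈ (Finset.range q), ‖z (t + 1) (c + b * q ^ t)‖ / (q * m) := by
                gcongr
                exact Finset.erase_subset _ _
            _ = _ := by
                rw [Finset.sum_const, Finset.card_range, nsmul_eq_mul]
                field_simp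
        calc _ ≤ _ := hzc
          _ ≤ (1 + 1 / (m : ℝ)) ^ t * ((1 + 1 / (m : ℝ)) * ‖z (t + 1) (c + b * q ^ t)‖) := by
            gcongr
          _ = _ := by ring

theorem isum {X : Type*} [MeasurableSpace X] (ν : Measure X) (s : Finset ℕ) (f : ℕ → X → ℝ)
    (c : ℕ → ℝ) (h : ∀ i ∈ s, Integrable (f i) ν ∧ ∫ x, f i x ∂ν ≤ c i) :
    Integrable (fun x => ∑ i ∈ s, f i x) ν ∧ ∫ x, ∑ i ∈ s, f i x ∂ν ≤ ∑ i ∈ s, c i := by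
  refine ⟨integrable_finsetSum _ fun i hi => (h i hi).1, ?_⟩
  rw [integral_finsetSum _ fun i hi => (h i hi).1]
  exact Finset.sum_le_sum fun i hi => (h i hi).2

theorem DD_part {q m j : ℕ} (hq : 0 < q) (φ : ℕ → ℝ) :
    ∑ a ∈ Finset.range (q ^ j), ∑ c ∈ DD q m j a, φ c = ∑ c ∈ Finset.range (q ^ m), φ c := by
  rw [← Finset.sum_fiberwise_of_maps_to (s := Finset.range (q ^ m)) (t := Finset.range (q ^ j))
    (g := fun c => c % q ^ j)]
  · apply Finset.sum_congr rfl
    intro a ha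
    rw [Finset.mem_range] at ha
    apply Finset.sum_congr _ (fun _ _ => rfl)
    unfold DD
    apply Finset.filter_congr
    intro c _
    unfold Nat.ModEq
    rw [Nat.mod_eq_of_lt ha]
  · intro c _
    exact Finset.mem_range.2 (Nat.mod_lt _ (pow_pos hq _))

variable {q : ℕ} [Fact q.Prime] {χ : ℚ_[q] → ℂ} {m : ℕ} {r : ℝ}

theorem fam_sum {ft : ℕ → ℕ → ℚ_[q] × ℚ_[q] → ℂ} (h : FamOK χ m (fun z => z) r ft)
    {j t : ℕ} (ht : t < q ^ j) (x) :
    ∀ l, j ≤ l → l ≤ m → ∑ c ∈ DD q l j t, ft l c x = ft j t x := by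
  have hq0 : 0 < q := (Fact.out : q.Prime).pos
  intro l hl
  induction l, hl using Nat.le_induction with
  | base =>
    intro _
    have : DD q j j t = {t} := by
      ext c
      rw [mem_DD, Finset.mem_singleton]
      constructor
      · rintro ⟨h1, h2⟩; exact Nat.ModEq.eq_of_lt_of_lt h2 h1 ht
      · rintro rfl; exact ⟨ht, rfl⟩
    rw [this, Finset.sum_singleton]
  | succ l hl ih =>
    intro hlm
    rw [DD_sum hq0 hl, ← ih (by omega)]
    exact Finset.sum_congr rfl fun c _ => (h.step l (by omega) c x).symm

open Classical in
/-- one level-set piece -/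
noncomputable def TI (q : ℕ) [Fact q.Prime] (m : ℕ) (F : ℕ → ℚ_[q] × ℚ_[q] → ℂ)
    (α₁ α₂ : ℝ) (t t' j : ℕ) (x : ℚ_[q] × ℚ_[q]) : ℝ :=
  if α₁ ≤ ‖∑ c ∈ DD q m (j + 1) t, F c x‖ ∧
        α₂ ≤ ‖∑ c ∈ DD q m (j + 1) t', F c x‖ then (1 : ℝ) else 0

theorem TI_nonneg (F : ℕ → ℚ_[q] × ℚ_[q] → ℂ) (α₁ α₂ : ℝ) (t t' j : ℕ) (x) :
    0 ≤ TI q m F α₁ α₂ t t' j x := by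
  unfold TI; split_ifs <;> simp

theorem main_abs (hχ : ChiOK χ) (hq2 : q ≠ 2) (hm : 1 ≤ m) (hr : 0 < r)
    (μ : Measure ℚ_[q]) [μ.IsAddHaarMeasure] [SigmaFinite μ]
    (F : ℕ → ℚ_[q] × ℚ_[q] → ℂ) (hF : ∀ c, QI χ m c (F c)) (hg : ∀ c, Gd r (F c))
    {A : ℝ} (hA : 0 < A)
    (hFA : ∀ x, ∑ c ∈ Finset.range (q ^ m), ‖F c x‖ ^ 2 ≤ A) :
    ∫ x, ‖∑ c ∈ Finset.range (q ^ m), F c x‖ ^ 6 ∂(μ.prod μ)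
      ≤ (134369280 * (q : ℝ) ^ 16 + 730) * (m : ℝ) ^ 11 * A ^ 2 *
        ∑ c ∈ Finset.range (q ^ m), ∫ x, ‖F c x‖ ^ 2 ∂(μ.prod μ) := by
  have hq0 : 0 < q := (Fact.out : q.Prime).pos
  have hqr : (0 : ℝ) < q := qpos
  have hm0 : (0 : ℝ) < m := by exact_mod_cast hm
  have hm1 : (1 : ℝ) ≤ m := by exact_mod_cast hm
  have hq1 : (1 : ℝ) ≤ q := (qgt1 (q := q)).le
  obtain ⟨B, hB⟩ : ∃ B, B = ∑ c ∈ Finset.range (q ^ m), ∫ x, ‖F c x‖ ^ 2 ∂(μ.prod μ) := ⟨_, rfl⟩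
  rw [← hB]
  have hB0 : 0 ≤ B := by
    rw [hB]; exact Finset.sum_nonneg fun _ _ => integral_nonneg fun _ => by positivity
  have hi2 : ∀ c, Integrable (fun x => ‖F c x‖ ^ 2) (μ.prod μ) := fun c =>
    Gd.integrable hr μ ⟨fun x t ht => by simp only [(hg c).1 x t ht],
      fun x hx => by simp [(hg c).2 x hx]⟩
  have hpyth : ∫ x, ‖∑ c ∈ Finset.range (q ^ m), F c x‖ ^ 2 ∂(μ.prod μ) = B := by
    rw [pythag, integral_finsetSum _ (fun c _ => hi2 c), hB]
    · intro i _ j _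
      exact Gd.integrable hr μ ⟨fun x t ht => by simp only [(hg i).1 x t ht, (hg j).1 x t ht],
        fun x hx => by simp [(hg i).2 x hx]⟩
    · intro i hi j hj hne
      refine low_orth hχ μ (hF i) (hF j) fun hc => hne ?_
      exact Nat.ModEq.eq_of_lt_of_lt hc (Finset.mem_range.1 hi) (Finset.mem_range.1 hj)
  obtain ⟨s, hs⟩ : ∃ s, s = √A := ⟨_, rfl⟩
  have hs0 : 0 < s := by rw [hs]; exact Real.sqrt_pos.2 hA
  have hsA : s ^ 2 = A := by rw [hs]; exact Real.sq_sqrt hA.le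
  -- the pieces
  obtain ⟨T, hT⟩ : ∃ T : ℕ → ℕ → ℕ → ℕ → ℕ → ℚ_[q] × ℚ_[q] → ℝ, T = fun i j a b b' x =>
    if b = b' then 0 else 64 * (2 ^ i * s) ^ 6 *
      TI q m F (2 ^ i * s / (3 * q)) (2 ^ i * s / (3 * q ^ 2 * m))
        (a + b * q ^ j) (a + b' * q ^ j) j x := ⟨_, rfl⟩
  have hT0 : ∀ i j a b b' x, 0 ≤ T i j a b b' x := by
    intro i j a b b' x
    rw [hT]
    simp only
    split_ifs
    · exact le_rfl
    · have := TI_nonneg (m := m) F (2 ^ i * s / (3 * q)) (2 ^ i * s / (3 * q ^ 2 * m))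
        (a + b * q ^ j) (a + b' * q ^ j) j x
      positivity
  have hTint : ∀ i j a b b', Gd r (T i j a b b') := by
    intro i j a b b'
    rw [hT]
    refine ⟨fun x t ht => ?_, fun x hx => ?_⟩
    · simp only [TI, (hg _).1 x t ht]
    · have : 0 < 2 ^ i * s / (3 * q) := by positivity
      simp only [TI, (hg _).2 x hx, Finset.sum_const_zero, norm_zero]
      have hn : ¬ (2 ^ i * s / (3 * q) ≤ 0 ∧ 2 ^ i * s / (3 * q ^ 2 * m) ≤ 0) := by
        intro hc; linarith [hc.1]
      rw [if_neg hn, mul_zero, ite_self]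
  have hTb : ∀ i j a b b', j < m → a < q ^ j → b < q → b' < q →
      ∫ x, T i j a b b' x ∂(μ.prod μ) ≤ 134369280 * (q : ℝ) ^ 13 * (m : ℝ) ^ 9 * A ^ 2
        * ∑ c ∈ DD q m j a, ∫ x, ‖F c x‖ ^ 2 ∂(μ.prod μ) := by
    intro i j a b b' hj ha hb hb'
    have hR : 0 ≤ ∑ c ∈ DD q m j a, ∫ x, ‖F c x‖ ^ 2 ∂(μ.prod μ) :=
      Finset.sum_nonneg fun _ _ => integral_nonneg fun _ => by positivity
    rw [hT]
    simp only
    by_cases hbb : b = b'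
    · simp only [hbb, if_true, integral_zero]
      positivity
    simp only [if_neg hbb]
    rw [integral_const_mul]
    have hlt : ∀ b, b < q → a + b * q ^ j < q ^ (j + 1) := by
      intro b hb
      calc a + b * q ^ j < q ^ j + b * q ^ j := by omega
          _ = (b + 1) * q ^ j := by ring
          _ ≤ q * q ^ j := Nat.mul_le_mul_right _ hb
          _ = q ^ (j + 1) := by ring
    have hA' : ∀ x, ∑ c ∈ DD q m j a, ‖F c x‖ ^ 2 ≤ A := fun x =>
      (Finset.sum_le_sum_of_subset_of_nonneg (Finset.filter_subset _ _)
        (fun _ _ _ => by positivity)).trans (hFA x)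
    have hα : 2 ^ i * s / (3 * q ^ 2 * m) ≤ 2 ^ i * s / (3 * q) := by
      apply div_le_div_of_nonneg_left (by positivity) (by positivity)
      have : (1 : ℝ) ≤ q * m := one_le_mul_of_one_le_of_one_le hq1 hm1
      nlinarith
    have := node_est hχ hq2 hm hr μ F hF hg hA hj hA' (modEq_child q j a b) (modEq_child q j a b')
      (child_ne hq0 hb hb' hbb) (hlt b hb) (hlt b' hb') (α₁ := 2 ^ i * s / (3 * q))
      (α₂ := 2 ^ i * s / (3 * q ^ 2 * m)) (by positivity) hα
    rw [integral_finsetSum _ (fun c _ => hi2 c)] at this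
    change _ * ∫ x, TI q m F (2 ^ i * s / (3 * q)) (2 ^ i * s / (3 * q ^ 2 * m))
        (a + b * q ^ j) (a + b' * q ^ j) j x ∂(μ.prod μ) ≤ _ at this
    have h2 := mul_le_mul_of_nonneg_left this
      (show (0 : ℝ) ≤ 64 * 729 * q ^ 10 * m ^ 4 by positivity)
    calc _ = 64 * 729 * (q : ℝ) ^ 10 * (m : ℝ) ^ 4 *
          ((2 ^ i * s / (3 * q)) ^ 2 * (2 ^ i * s / (3 * q ^ 2 * m)) ^ 4 *
          ∫ x, TI q m F (2 ^ i * s / (3 * q)) (2 ^ i * s / (3 * q ^ 2 * m))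
        (a + b * q ^ j) (a + b' * q ^ j) j x ∂(μ.prod μ)) := by
          field_simp; norm_num; ring
      _ ≤ _ := h2
      _ = _ := by ring
  -- sum of the pieces
  have hsum := isum (μ.prod μ) (Finset.range (q * m)) _ _ fun i _ =>
    isum (μ.prod μ) (Finset.range m) _ _ fun j hj =>
    isum (μ.prod μ) (Finset.range (q ^ j)) _ _ fun a ha =>
    isum (μ.prod μ) (Finset.range q) _ _ fun b hb =>
    isum (μ.prod μ) (Finset.range q) _ _ fun b' hb' =>
      ⟨(hTint i j a b b').integrable hr μ, hTb i j a b b' (Finset.mem_range.1 hj)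
        (Finset.mem_range.1 ha) (Finset.mem_range.1 hb) (Finset.mem_range.1 hb')⟩
  simp only [Finset.sum_const, Finset.card_range, nsmul_eq_mul, ← Finset.mul_sum,
    DD_part hq0] at hsum
  rw [← hB] at hsum
  obtain ⟨hS1, hS2⟩ := hsum
  have hpt : ∀ x, ‖∑ c ∈ Finset.range (q ^ m), F c x‖ ^ 6 ≤
      (A ^ 2 * ‖∑ c ∈ Finset.range (q ^ m), F c x‖ ^ 2
        + 729 * A ^ 2 * ∑ c ∈ Finset.range (q ^ m), ‖F c x‖ ^ 2)
      + ∑ i ∈ Finset.range (q * m), ∑ j ∈ Finset.range m, ∑ a ∈ Finset.range (q ^ j),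
        ∑ b ∈ Finset.range q, ∑ b' ∈ Finset.range q, T i j a b b' x := by
    intro x
    obtain ⟨ft, h, hftm⟩ := fam_exists (p := fun z => z)
      ⟨rfl, fun _ => le_rfl, fun _ _ _ => rfl⟩ hχ F hF hg
    have hz : ft 0 0 x = ∑ c ∈ Finset.range (q ^ m), F c x := by
      rw [← fam_sum h (j := 0) (t := 0) (by simp) x m (Nat.zero_le _) le_rfl, hftm]
      apply Finset.sum_congr _ (fun _ _ => rfl)
      ext c
      simp [mem_DD, Nat.modEq_one]
    obtain ⟨V, hV⟩ : ∃ V, V = ‖∑ c ∈ Finset.range (q ^ m), F c x‖ := ⟨_, rfl⟩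
    have hV0 : 0 ≤ V := by rw [hV]; positivity
    have hsm : 0 ≤ 729 * A ^ 2 * ∑ c ∈ Finset.range (q ^ m), ‖F c x‖ ^ 2 := by positivity
    have hA2 : 0 ≤ A ^ 2 * V ^ 2 := by positivity
    have hTs : 0 ≤ ∑ i ∈ Finset.range (q * m), ∑ j ∈ Finset.range m, ∑ a ∈ Finset.range (q ^ j),
        ∑ b ∈ Finset.range q, ∑ b' ∈ Finset.range q, T i j a b b' x :=
      Finset.sum_nonneg fun _ _ => Finset.sum_nonneg fun _ _ => Finset.sum_nonneg fun _ _ =>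
        Finset.sum_nonneg fun _ _ => Finset.sum_nonneg fun _ _ => hT0 _ _ _ _ _ _
    have hbn := bn hq0 hm (fun l c => ft l c x) (fun l hl c => h.step l hl c x) m le_rfl
    simp only [hz] at hbn
    rw [← hV] at hbn ⊢
    by_cases hVA : V ^ 2 ≤ A
    · have : V ^ 6 ≤ A ^ 2 * V ^ 2 := by
        calc V ^ 6 = (V ^ 2) ^ 2 * V ^ 2 := by ring
          _ ≤ _ := by gcongr
      linarith
    rcases hbn with ⟨c, hc, hVc⟩ | ⟨j, hj, a, ha, b, hb, b', hb', hbb, h1, h2⟩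
    · rw [hftm] at hVc
      have hV3 : V ≤ 3 * ‖F c x‖ := by
        refine hVc.trans ?_
        gcongr
        exact kappa_pow_le hm le_rfl
      have hcs : ‖F c x‖ ^ 2 ≤ ∑ c ∈ Finset.range (q ^ m), ‖F c x‖ ^ 2 :=
        Finset.single_le_sum (f := fun c => ‖F c x‖ ^ 2) (fun _ _ => by positivity)
          (Finset.mem_range.2 hc)
      have : V ^ 6 ≤ 729 * A ^ 2 * ∑ c ∈ Finset.range (q ^ m), ‖F c x‖ ^ 2 := by
        have hcA := hcs.trans (hFA x)
        calc V ^ 6 ≤ (3 * ‖F c x‖) ^ 6 := by gcongr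
          _ = 729 * (‖F c x‖ ^ 2) ^ 2 * ‖F c x‖ ^ 2 := by ring
          _ ≤ _ := by gcongr
      linarith
    · push Not at hVA
      have hsV : s ≤ V := by
        apply le_of_lt
        apply lt_of_pow_lt_pow_left₀ 2 hV0
        rwa [hsA]
      obtain ⟨i, hi1, hi2⟩ := exists_nat_pow_near (x := V / s) (y := 2)
        (by rwa [le_div_iff₀ hs0, one_mul]) one_lt_two
      rw [le_div_iff₀ hs0] at hi1
      rw [div_lt_iff₀ hs0] at hi2
      have hi : i < q * m := by
        have hcs : V ^ 2 ≤ (q : ℝ) ^ m * A := by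
          rw [hV]
          refine (sq_sum_le_card _ _).trans ?_
          rw [Finset.card_range]
          push_cast
          exact mul_le_mul_of_nonneg_left (hFA x) (by positivity)
        have h3 : (2 : ℝ) ^ (2 * i) ≤ (2 : ℝ) ^ (q * m) := by
          have h4 : (2 : ℝ) ^ (2 * i) * A ≤ (q : ℝ) ^ m * A := by
            refine le_trans ?_ hcs
            calc (2 : ℝ) ^ (2 * i) * A = (2 ^ i * s) ^ 2 := by rw [← hsA]; ring
              _ ≤ _ := by gcongr
          have h5 := le_of_mul_le_mul_right h4 hA
          refine h5.trans ?_
          rw [pow_mul]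
          gcongr
          exact_mod_cast (Nat.lt_two_pow_self (n := q)).le
        have h4 : 2 * i ≤ q * m := (pow_le_pow_iff_right₀ one_lt_two).1 h3
        have : 0 < q * m := Nat.mul_pos hq0 hm
        omega
      have hlt : ∀ b, b < q → a + b * q ^ j < q ^ (j + 1) := by
        intro b hb
        calc a + b * q ^ j < q ^ j + b * q ^ j := by omega
            _ = (b + 1) * q ^ j := by ring
            _ ≤ q * q ^ j := Nat.mul_le_mul_right _ hb
            _ = q ^ (j + 1) := by ring
      rw [← fam_sum h (hlt b hb) x m hj le_rfl, hftm] at h1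
      rw [← fam_sum h (hlt b' hb') x m hj le_rfl, hftm] at h2
      have hTv : V ^ 6 ≤ T i j a b b' x := by
        rw [hT]
        simp only [if_neg hbb]
        rw [TI, if_pos, mul_one]
        · calc V ^ 6 ≤ (2 ^ (i + 1) * s) ^ 6 := by gcongr
            _ = _ := by ring
        · constructor
          · rw [div_le_iff₀ (by positivity)]
            linarith
          · rw [div_le_iff₀ (by positivity)]
            linarith
      have c1 : T i j a b b' x ≤ ∑ b' ∈ Finset.range q, T i j a b b' x :=
        Finset.single_le_sum (f := fun b' => T i j a b b' x) (fun _ _ => hT0 _ _ _ _ _ _)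
          (Finset.mem_range.2 hb')
      have c2 : _ ≤ ∑ b ∈ Finset.range q, ∑ b' ∈ Finset.range q, T i j a b b' x :=
        Finset.single_le_sum (f := fun b => ∑ b' ∈ Finset.range q, T i j a b b' x)
          (fun _ _ => Finset.sum_nonneg fun _ _ => hT0 _ _ _ _ _ _) (Finset.mem_range.2 hb)
      have c3 : _ ≤ ∑ a ∈ Finset.range (q ^ j), ∑ b ∈ Finset.range q, ∑ b' ∈ Finset.range q,
          T i j a b b' x :=
        Finset.single_le_sum (f := fun a => ∑ b ∈ Finset.range q, ∑ b' ∈ Finset.range q,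
          T i j a b b' x)
          (fun _ _ => Finset.sum_nonneg fun _ _ => Finset.sum_nonneg fun _ _ => hT0 _ _ _ _ _ _)
          (Finset.mem_range.2 ha)
      have c4 : _ ≤ ∑ j ∈ Finset.range m, ∑ a ∈ Finset.range (q ^ j), ∑ b ∈ Finset.range q,
          ∑ b' ∈ Finset.range q, T i j a b b' x :=
        Finset.single_le_sum (f := fun j => ∑ a ∈ Finset.range (q ^ j), ∑ b ∈ Finset.range q,
          ∑ b' ∈ Finset.range q, T i j a b b' x)
          (fun _ _ => Finset.sum_nonneg fun _ _ => Finset.sum_nonneg fun _ _ =>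
            Finset.sum_nonneg fun _ _ => hT0 _ _ _ _ _ _)
          (Finset.mem_range.2 hj)
      have c5 : _ ≤ ∑ i ∈ Finset.range (q * m), ∑ j ∈ Finset.range m,
          ∑ a ∈ Finset.range (q ^ j), ∑ b ∈ Finset.range q,
          ∑ b' ∈ Finset.range q, T i j a b b' x :=
        Finset.single_le_sum (f := fun i => ∑ j ∈ Finset.range m, ∑ a ∈ Finset.range (q ^ j),
          ∑ b ∈ Finset.range q, ∑ b' ∈ Finset.range q, T i j a b b' x)
          (fun _ _ => Finset.sum_nonneg fun _ _ => Finset.sum_nonneg fun _ _ =>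
            Finset.sum_nonneg fun _ _ => Finset.sum_nonneg fun _ _ => hT0 _ _ _ _ _ _)
          (Finset.mem_range.2 hi)
      linarith
  have hg2 : Integrable (fun x => A ^ 2 * ‖∑ c ∈ Finset.range (q ^ m), F c x‖ ^ 2) (μ.prod μ) :=
    Gd.integrable hr μ ⟨fun x t ht => by simp only [(hg _).1 x t ht],
      fun x hx => by simp [(hg _).2 x hx]⟩
  have hg3 : Integrable (fun x => 729 * A ^ 2 * ∑ c ∈ Finset.range (q ^ m), ‖F c x‖ ^ 2)
      (μ.prod μ) :=
    Gd.integrable hr μ ⟨fun x t ht => by simp only [(hg _).1 x t ht],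
      fun x hx => by simp [(hg _).2 x hx]⟩
  have hg1 : Integrable (fun x => ‖∑ c ∈ Finset.range (q ^ m), F c x‖ ^ 6) (μ.prod μ) :=
    Gd.integrable hr μ ⟨fun x t ht => by simp only [(hg _).1 x t ht],
      fun x hx => by simp [(hg _).2 x hx]⟩
  refine (integral_mono hg1 ((hg2.add hg3).add hS1) hpt).trans ?_
  rw [integral_add' (hg2.add hg3) hS1, integral_add' hg2 hg3, integral_const_mul, integral_const_mul, hpyth,
    integral_finsetSum _ (fun c _ => hi2 c), ← hB]
  have e1 : (1 : ℝ) ≤ (m : ℝ) ^ 11 := one_le_pow₀ hm1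
  have e2 : A ^ 2 * B ≤ (m : ℝ) ^ 11 * (A ^ 2 * B) :=
    le_mul_of_one_le_left (by positivity) e1
  refine (add_le_add le_rfl hS2).trans ?_
  push_cast
  nlinarith

end Assembly

section FourierPart

variable {q : ℕ} [Fact q.Prime] {χ : ℚ_[q] → ℂ}

theorem gd_of_schwartz {F : ℚ_[q] × ℚ_[q] → ℂ} (h1 : IsLocallyConstant F)
    (h2 : HasCompactSupport F) : ∃ r, 0 < r ∧ Gd r F := by
  obtain ⟨δ, hδ, hc⟩ := lebesgue_number_lemma_of_metric (s := tsupport F)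
    (c := fun y : ℚ_[q] × ℚ_[q] => F ⁻¹' {F y}) h2 (fun y => h1 {F y})
    (fun y _ => Set.mem_iUnion.2 ⟨y, rfl⟩)
  have hc' : ∀ x ∈ tsupport F, ∀ y, dist y x < δ → F y = F x := by
    intro x hx y hy
    obtain ⟨i, hi⟩ := hc x hx
    have e1 : F y = F i := hi hy
    have e2 : F x = F i := hi (Metric.mem_ball_self hδ)
    rw [e1, e2]
  obtain ⟨R, hR⟩ := h2.isBounded.exists_norm_le
  refine ⟨min (δ / 2) (|R| + 1)⁻¹, by positivity, ?_, ?_⟩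
  · intro x t ht
    have ht' : ‖t‖ < δ := by
      have := ht.trans (min_le_left _ _); linarith
    by_cases hx : x ∈ tsupport F
    · exact hc' x hx _ (by simpa [dist_eq_norm] using ht')
    by_cases hy : x + t ∈ tsupport F
    · exact (hc' _ hy x (by simpa [dist_eq_norm] using ht')).symm
    · rw [image_eq_zero_of_notMem_tsupport hx, image_eq_zero_of_notMem_tsupport hy]
  · intro x hx
    by_contra hne
    have hxs : x ∈ tsupport F := by
      by_contra hc; exact hne (image_eq_zero_of_notMem_tsupport hc)
    have h3 := hR x hxs
    have h4 : (|R| + 1)⁻¹⁻¹ ≤ (min (δ / 2) (|R| + 1)⁻¹)⁻¹ :=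
      inv_anti₀ (by positivity) (min_le_right _ _)
    rw [inv_inv] at h4
    have := le_abs_self R
    linarith

theorem norm_dot_le {t x : ℚ_[q] × ℚ_[q]} {a b : ℝ} (ht : ‖t‖ ≤ a) (hx : ‖x‖ ≤ b) (h : a * b ≤ 1) :
    ‖t.1 * x.1 + t.2 * x.2‖ ≤ 1 := by
  refine norm_add3 ?_ ?_
  · exact (norm_mul3 ((norm_fst_le t).trans ht) ((norm_fst_le x).trans hx) rfl).trans h
  · exact (norm_mul3 ((norm_snd_le t).trans ht) ((norm_snd_le x).trans hx) rfl).trans h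

/-- inverse transform -/
noncomputable def iF (q : ℕ) [Fact q.Prime] (μ : Measure ℚ_[q]) (χ : ℚ_[q] → ℂ)
    (G : ℚ_[q] × ℚ_[q] → ℂ) (x : ℚ_[q] × ℚ_[q]) : ℂ :=
  ∫ ξ, G ξ * χ (ξ.1 * x.1 + ξ.2 * x.2) ∂(μ.prod μ)

/-- shifts detecting nontriviality of the character at large points -/
theorem exists_shift (hχ : ChiOK χ) (z : ℚ_[q] × ℚ_[q]) {s : ℝ} (hs : 0 < s)
    (hz : q / s < ‖z‖) : ∃ u : ℚ_[q] × ℚ_[q], ‖u‖ ≤ s ∧ χ (u.1 * z.1 + u.2 * z.2) ≠ 1 := by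
  obtain ⟨x, hx, hx1⟩ := hχ.nontriv
  have hq := qpos (q := q)
  have hv : ∀ w : ℚ_[q], q / s < ‖w‖ → ‖x / w‖ ≤ s ∧ x / w * w = x := by
    intro w hw
    have hw0 : 0 < ‖w‖ := lt_trans (by positivity) hw
    refine ⟨?_, div_mul_cancel₀ _ (norm_pos_iff.1 hw0)⟩
    rw [norm_div, div_le_iff₀ hw0]
    rw [div_lt_iff₀ hs] at hw
    linarith
  rw [Prod.norm_def, lt_max_iff] at hz
  rcases hz with hz | hz
  · obtain ⟨h1, h2⟩ := hv _ hz
    refine ⟨(x / z.1, 0), ?_, ?_⟩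
    · rw [Prod.norm_def]; simpa using ⟨by simpa using h1, hs.le⟩
    · simpa [h2] using hx1
  · obtain ⟨h1, h2⟩ := hv _ hz
    refine ⟨(0, x / z.2), ?_, ?_⟩
    · rw [Prod.norm_def]; simpa using ⟨hs.le, by simpa using h1⟩
    · simpa [h2] using hx1

theorem gd_iF (hχ : ChiOK χ) (μ : Measure ℚ_[q]) [μ.IsAddHaarMeasure] [SigmaFinite μ] {r : ℝ}
    (hr : 0 < r) {G : ℚ_[q] × ℚ_[q] → ℂ} (h : Gd r G) : Gd (r / q) (iF q μ χ G) := by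
  have hq := qpos (q := q)
  have hq1 := (qgt1 (q := q)).le
  refine ⟨fun x t ht => ?_, fun x hx => ?_⟩
  · unfold iF
    congr 1
    ext ξ
    by_cases hξ : r⁻¹ < ‖ξ‖
    · simp [h.2 ξ hξ]
    · congr 1
      apply hχ.eq_of_sub
      have : ξ.1 * (x + t).1 + ξ.2 * (x + t).2 - (ξ.1 * x.1 + ξ.2 * x.2)
        = ξ.1 * t.1 + ξ.2 * t.2 := by simp; ring
      rw [this]
      apply norm_dot_le (not_lt.1 hξ) ht
      rw [← mul_div_assoc, inv_mul_cancel₀ hr.ne', div_le_one hq]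
      exact hq1
  · obtain ⟨u, hu, hu1⟩ := exists_shift hχ x hr (by rwa [inv_div] at hx)
    refine integral_zero_of_shift μ _ u _ hu1 ?_
    intro ξ
    rw [h.1 ξ u hu, show (ξ + u).1 * x.1 + (ξ + u).2 * x.2
      = (u.1 * x.1 + u.2 * x.2) + (ξ.1 * x.1 + ξ.2 * x.2) by simp; ring, hχ.mul]
    ring

theorem fourier_eq (μ : Measure ℚ_[q]) [SigmaFinite μ] (F : ℚ_[q] × ℚ_[q] → ℂ) (ξ) :
    qpFourier q μ χ F ξ = iF q μ χ F (-ξ) := by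
  unfold qpFourier iF
  congr 1
  ext x
  congr 2
  simp; ring

theorem gd_fourier (hχ : ChiOK χ) (μ : Measure ℚ_[q]) [μ.IsAddHaarMeasure] [SigmaFinite μ] {r : ℝ}
    (hr : 0 < r) {F : ℚ_[q] × ℚ_[q] → ℂ} (h : Gd r F) : Gd (r / q) (qpFourier q μ χ F) := by
  have := gd_iF hχ μ hr h
  refine ⟨fun x t ht => ?_, fun x hx => ?_⟩
  · rw [fourier_eq, fourier_eq, neg_add]
    exact this.1 _ _ (by rwa [norm_neg])
  · rw [fourier_eq]
    exact this.2 _ (by rwa [norm_neg])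

/-- the localized transform -/
noncomputable def Gc (q : ℕ) [Fact q.Prime] (μ : Measure ℚ_[q]) [SigmaFinite μ] (χ : ℚ_[q] → ℂ)
    (m : ℕ) (F : ℚ_[q] × ℚ_[q] → ℂ) (c : ℕ) : ℚ_[q] × ℚ_[q] → ℂ :=
  (qpItv q m c ×ˢ (Set.univ : Set ℚ_[q])).indicator (qpFourier q μ χ F)

theorem proj_eq (μ : Measure ℚ_[q]) [SigmaFinite μ] (m c : ℕ) (F : ℚ_[q] × ℚ_[q] → ℂ) :
    qpProj q μ χ F (qpItv q m c) = iF q μ χ (Gc q μ χ m F c) := by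
  ext x
  unfold qpProj iF
  have hcl : IsClosed (qpItv q m c) :=
    isClosed_le (continuous_norm.comp (continuous_id.sub continuous_const)) continuous_const
  rw [← integral_indicator ((hcl.measurableSet).prod MeasurableSet.univ)]
  congr 1
  ext ξ
  rw [Gc, Set.indicator_mul_left]

theorem gd_Gc (hχ : ChiOK χ) (μ : Measure ℚ_[q]) [μ.IsAddHaarMeasure] [SigmaFinite μ] {r : ℝ}
    (hr : 0 < r) {F : ℚ_[q] × ℚ_[q] → ℂ} (h : Gd r F) (m c : ℕ) :
    Gd (min (r / q) ((q : ℝ) ^ (-(m : ℤ)))) (Gc q μ χ m F c) := by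
  have hq := qpos (q := q)
  have hpos : 0 < min (r / q) ((q : ℝ) ^ (-(m : ℤ))) := lt_min (by positivity) (by positivity)
  have hf := (gd_fourier hχ μ hr h).mono hpos (min_le_left _ _)
  unfold Gc
  refine ⟨fun x t ht => ?_, fun x hx => ?_⟩
  · have ht1 : ‖t.1‖ ≤ (q : ℝ) ^ (-(m : ℤ)) :=
      (norm_fst_le t).trans (ht.trans (min_le_right _ _))
    have : x + t ∈ qpItv q m c ×ˢ (Set.univ : Set ℚ_[q]) ↔
        x ∈ qpItv q m c ×ˢ (Set.univ : Set ℚ_[q]) := by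
      simp only [qpItv, Set.mem_prod, Set.mem_univ, and_true, Set.mem_setOf_eq, Prod.fst_add]
      constructor
      · intro h1
        have := norm_sub3 h1 ht1
        rwa [show x.1 + t.1 - c - t.1 = x.1 - c by ring] at this
      · intro h1
        have := norm_add3 h1 ht1
        rwa [show x.1 - c + t.1 = x.1 + t.1 - c by ring] at this
    by_cases hx : x ∈ qpItv q m c ×ˢ (Set.univ : Set ℚ_[q])
    · rw [Set.indicator_of_mem hx, Set.indicator_of_mem (this.2 hx), hf.1 x t ht]
    · rw [Set.indicator_of_notMem hx, Set.indicator_of_notMem (fun hc => hx (this.1 hc))]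
  · classical
    rw [Set.indicator_apply, hf.2 x hx, ite_self]

theorem qi_proj (hχ : ChiOK χ) (μ : Measure ℚ_[q]) [SigmaFinite μ] (m c : ℕ)
    {F : ℚ_[q] × ℚ_[q] → ℂ}
    (hs : ∀ p : ℚ_[q] × ℚ_[q],
        ¬ (‖p.1‖ ≤ 1 ∧ ‖p.2 - p.1 ^ 2‖ ≤ (q : ℝ) ^ (-((2 * m : ℕ) : ℤ))) →
        qpFourier q μ χ F p = 0) :
    QI χ m c (qpProj q μ χ F (qpItv q m c)) := by
  have hq := qpos (q := q)
  rw [proj_eq]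
  intro x u hu
  unfold iF
  rw [← integral_const_mul]
  congr 1
  ext ξ
  by_cases hξ : ξ ∈ qpItv q m c ×ˢ (Set.univ : Set ℚ_[q])
  swap
  · rw [Gc, Set.indicator_of_notMem hξ]; simp
  by_cases hξ2 : ‖ξ.1‖ ≤ 1 ∧ ‖ξ.2 - ξ.1 ^ 2‖ ≤ (q : ℝ) ^ (-((2 * m : ℕ) : ℤ))
  swap
  · classical
    rw [Gc, Set.indicator_apply, hs ξ hξ2]; simp
  have h1 : ‖ξ.1 - c‖ ≤ (q : ℝ) ^ (-(m : ℤ)) := by simpa [qpItv] using hξ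
  obtain ⟨hu1, hu2⟩ := hu
  have key : χ (ξ.1 * u.1 + ξ.2 * u.2) = ph χ c u := by
    apply hχ.eq_of_sub
    have e : ξ.1 * u.1 + ξ.2 * u.2 - ((c : ℚ_[q]) * u.1 + (c : ℚ_[q]) ^ 2 * u.2)
      = ((ξ.1 - c) * (u.1 + 2 * c * u.2) + (ξ.2 - ξ.1 ^ 2) * u.2)
        + (ξ.1 - c) * (ξ.1 - c) * u.2 := by ring
    rw [e]
    have e1 : (q : ℝ) ^ (-(m : ℤ)) * (q : ℝ) ^ (m : ℤ) = 1 := by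
      rw [← zpow_add₀ hq.ne']; simp
    have e2 : (q : ℝ) ^ (-((2 * m : ℕ) : ℤ)) * (q : ℝ) ^ (2 * m : ℤ) = 1 := by
      rw [← zpow_add₀ hq.ne']; simp
    have e3 : (q : ℝ) ^ (-(m : ℤ)) * (q : ℝ) ^ (-(m : ℤ)) * (q : ℝ) ^ (2 * m : ℤ) = 1 := by
      rw [← zpow_add₀ hq.ne', ← zpow_add₀ hq.ne']; ring_nf; simp
    exact norm_add3 (norm_add3 (norm_mul3 h1 hu1 e1) (norm_mul3 hξ2.2 hu2 e2))
      (norm_mul3 (norm_mul3 h1 h1 rfl) hu2 e3)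
  rw [show ξ.1 * (x + u).1 + ξ.2 * (x + u).2
      = (ξ.1 * u.1 + ξ.2 * u.2) + (ξ.1 * x.1 + ξ.2 * x.2) by simp; ring, hχ.mul, key]
  ring

open scoped Pointwise in
theorem vol_mul (μ : Measure ℚ_[q]) [μ.IsAddHaarMeasure] [SigmaFinite μ]
    (hμ : μ {x : ℚ_[q] | ‖x‖ ≤ 1} = 1) (N : ℕ) :
    μ (Metric.closedBall 0 ((q : ℝ) ^ N)) * μ (Metric.closedBall 0 ((q : ℝ) ^ N)⁻¹) = 1 := by
  have hq0 : (q : ℚ_[q]) ≠ 0 := by exact_mod_cast (Fact.out : q.Prime).ne_zero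
  have hqr := qpos (q := q)
  have hb : ∀ g : (ℚ_[q])ˣ, Metric.closedBall (0 : ℚ_[q]) ‖(g : ℚ_[q])‖
      = g • {x : ℚ_[q] | ‖x‖ ≤ 1} := by
    intro g
    have hg : 0 < ‖(g : ℚ_[q])‖ := norm_pos_iff.2 g.ne_zero
    ext x
    rw [Set.mem_smul_set_iff_inv_smul_mem]
    simp only [Metric.mem_closedBall, dist_zero_right, Set.mem_setOf_eq, Units.smul_def,
      smul_eq_mul, norm_mul, Units.val_inv_eq_inv_val, norm_inv]
    rw [inv_mul_le_iff₀ hg, mul_one]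
  obtain ⟨g, hg⟩ : ∃ g : (ℚ_[q])ˣ, (g : ℚ_[q]) = (q : ℚ_[q]) ^ N :=
    ⟨Units.mk0 _ (pow_ne_zero N hq0), rfl⟩
  have n1 : ‖(g : ℚ_[q])‖ = ((q : ℝ) ^ N)⁻¹ := by
    rw [hg, norm_pow, Padic.norm_p, inv_pow]
  have n2 : ‖((g⁻¹ : (ℚ_[q])ˣ) : ℚ_[q])‖ = (q : ℝ) ^ N := by
    rw [Units.val_inv_eq_inv_val, norm_inv, n1, inv_inv]
  rw [← n1, ← n2, hb, hb, ← distribHaarChar_mul, ← distribHaarChar_mul, hμ, mul_one, mul_one,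
    ← ENNReal.coe_mul, ← map_mul]
  simp

theorem prod_ball (s : ℝ) : Metric.closedBall (0 : ℚ_[q] × ℚ_[q]) s
    = Metric.closedBall 0 s ×ˢ Metric.closedBall 0 s := by
  rw [closedBall_prod_same]; rfl

theorem inversion (hχ : ChiOK χ) (μ : Measure ℚ_[q]) [μ.IsAddHaarMeasure] [SigmaFinite μ]
    (hμ : μ {x : ℚ_[q] | ‖x‖ ≤ 1} = 1) {r : ℝ}
    (hr : 0 < r) {F : ℚ_[q] × ℚ_[q] → ℂ} (h : Gd r F) (x : ℚ_[q] × ℚ_[q]) :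
    iF q μ χ (qpFourier q μ χ F) x = F x := by
  have hq := qpos (q := q)
  have hq1 := qgt1 (q := q)
  obtain ⟨N, hN⟩ := pow_unbounded_of_one_lt (q / r) hq1
  have hqN : (0 : ℝ) < (q : ℝ) ^ N := by positivity
  have hNr : ((q : ℝ) ^ N)⁻¹ ≤ r := by
    rw [inv_le_comm₀ hqN hr]
    refine le_trans ?_ hN.le
    rw [div_eq_mul_inv]
    exact le_mul_of_one_le_left (by positivity) hq1.le
  obtain ⟨B, hB⟩ : ∃ B, B = Metric.closedBall (0 : ℚ_[q] × ℚ_[q]) ((q : ℝ) ^ N) := ⟨_, rfl⟩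
  have hBm : MeasurableSet B := by rw [hB]; exact Metric.isClosed_closedBall.measurableSet
  have hBfin : (μ.prod μ) B < ⊤ := by
    rw [hB]; exact (isCompact_closedBall _ _).measure_lt_top
  have hfour := gd_fourier hχ μ hr h
  have hadd : ∀ (s : ℝ) (y u : ℚ_[q] × ℚ_[q]), ‖u‖ ≤ s → (‖y + u‖ ≤ s ↔ ‖y‖ ≤ s) := by
    have hone : ∀ (s : ℝ) (y u : ℚ_[q] × ℚ_[q]), ‖u‖ ≤ s → ‖y‖ ≤ s → ‖y + u‖ ≤ s := by
      intro s y u hu hy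
      rw [Prod.norm_def] at *
      exact max_le (norm_add3 ((le_max_left _ _).trans hy) ((le_max_left _ _).trans hu))
        (norm_add3 ((le_max_right _ _).trans hy) ((le_max_right _ _).trans hu))
    intro s y u hu
    refine ⟨fun hy => ?_, hone s y u hu⟩
    have := hone s (y + u) (-u) (by rwa [norm_neg]) hy
    simpa using this
  -- kernel
  have hker : ∀ z : ℚ_[q] × ℚ_[q], ∫ ξ, B.indicator (fun _ => (1 : ℂ)) ξ
      * χ (ξ.1 * z.1 + ξ.2 * z.2) ∂(μ.prod μ)
      = (Metric.closedBall (0 : ℚ_[q] × ℚ_[q]) ((q : ℝ) ^ N)⁻¹).indicator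
        (fun _ => (((μ.prod μ).real B : ℝ) : ℂ)) z := by
    intro z
    by_cases hz : ‖z‖ ≤ ((q : ℝ) ^ N)⁻¹
    · rw [Set.indicator_of_mem (by simpa using hz)]
      have : ∀ ξ, B.indicator (fun _ => (1 : ℂ)) ξ * χ (ξ.1 * z.1 + ξ.2 * z.2)
          = B.indicator (fun _ => (1 : ℂ)) ξ := by
        intro ξ
        by_cases hξ : ξ ∈ B
        · rw [Set.indicator_of_mem hξ, hχ.triv, mul_one]
          rw [hB] at hξ
          exact norm_dot_le (by simpa using hξ) hz (mul_inv_cancel₀ hqN.ne').le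
        · simp [Set.indicator_of_notMem hξ]
      simp only [this]
      rw [integral_indicator hBm]
      simp
    · rw [Set.indicator_of_notMem (by simpa using hz)]
      push Not at hz
      have hz' : ∃ u : ℚ_[q] × ℚ_[q], ‖u‖ ≤ (q : ℝ) ^ N ∧ χ (u.1 * z.1 + u.2 * z.2) ≠ 1 := by
        rw [Prod.norm_def, lt_max_iff] at hz
        rcases hz with hz | hz
        · obtain ⟨v, hv, hv1⟩ := hχ.exists_ne' z.1 N (by rw [zpow_neg]; simpa using hz)
          refine ⟨(v, 0), ?_, by simpa [mul_comm] using hv1⟩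
          rw [Prod.norm_def]; simpa using hv
        · obtain ⟨v, hv, hv1⟩ := hχ.exists_ne' z.2 N (by rw [zpow_neg]; simpa using hz)
          refine ⟨(0, v), ?_, by simpa [mul_comm] using hv1⟩
          rw [Prod.norm_def]; simpa using hv
      obtain ⟨u, hu, hu1⟩ := hz'
      refine integral_zero_of_shift μ _ u _ hu1 ?_
      intro ξ
      have hi : B.indicator (fun _ => (1 : ℂ)) (ξ + u) = B.indicator (fun _ => (1 : ℂ)) ξ := by
        classical
        rw [Set.indicator_apply, Set.indicator_apply]
        congr 1
        rw [hB]
        simpa using hadd _ ξ u hu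
      rw [hi, show (ξ + u).1 * z.1 + (ξ + u).2 * z.2
      = (u.1 * z.1 + u.2 * z.2) + (ξ.1 * z.1 + ξ.2 * z.2) by simp; ring, hχ.mul]
      ring
  have hBi : Integrable (B.indicator (fun _ => (1 : ℂ))) (μ.prod μ) :=
    (integrable_indicator_iff hBm).2 (integrableOn_const hBfin.ne)
  have hcont : Continuous (fun p : (ℚ_[q] × ℚ_[q]) × (ℚ_[q] × ℚ_[q]) =>
      χ (p.1.1 * (x - p.2).1 + p.1.2 * (x - p.2).2)) :=
    hχ.continuous.comp (by fun_prop)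
  have hint2 : Integrable (Function.uncurry fun (ξ y : ℚ_[q] × ℚ_[q]) =>
      (B.indicator (fun _ => (1 : ℂ)) ξ * F y) * χ (ξ.1 * (x - y).1 + ξ.2 * (x - y).2))
      ((μ.prod μ).prod (μ.prod μ)) :=
    (hBi.mul_prod (h.integrable hr μ)).mul_bdd (c := 1) hcont.aestronglyMeasurable
      (Filter.Eventually.of_forall fun p => (hχ.norm _).le)
  have hvol : (μ.prod μ).real B
      * (μ.prod μ).real (Metric.closedBall (0 : ℚ_[q] × ℚ_[q]) ((q : ℝ) ^ N)⁻¹) = 1 := by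
    rw [hB, Measure.real, Measure.real, ← ENNReal.toReal_mul, prod_ball, prod_ball,
      Measure.prod_prod, Measure.prod_prod]
    have := vol_mul μ hμ N
    rw [mul_mul_mul_comm, this]
    simp
  calc iF q μ χ (qpFourier q μ χ F) x
      = ∫ ξ, ∫ y, (B.indicator (fun _ => (1 : ℂ)) ξ * F y)
          * χ (ξ.1 * (x - y).1 + ξ.2 * (x - y).2) ∂(μ.prod μ) ∂(μ.prod μ) := by
        unfold iF
        congr 1
        ext ξ
        by_cases hξ : ξ ∈ B
        · rw [Set.indicator_of_mem hξ, qpFourier, ← integral_mul_const]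
          congr 1
          ext y
          rw [one_mul, mul_assoc, ← hχ.mul]
          congr 2
          simp; ring
        · rw [Set.indicator_of_notMem hξ]
          rw [hfour.2 ξ]
          · simp
          · rw [hB] at hξ
            rw [inv_div]
            have : (q : ℝ) ^ N < ‖ξ‖ := by simpa using hξ
            linarith
    _ = ∫ y, ∫ ξ, (B.indicator (fun _ => (1 : ℂ)) ξ * F y)
          * χ (ξ.1 * (x - y).1 + ξ.2 * (x - y).2) ∂(μ.prod μ) ∂(μ.prod μ) :=
        integral_integral_swap hint2
    _ = ∫ y, F y * (Metric.closedBall (0 : ℚ_[q] × ℚ_[q]) ((q : ℝ) ^ N)⁻¹).indicator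
        (fun _ => (((μ.prod μ).real B : ℝ) : ℂ)) (x - y) ∂(μ.prod μ) := by
        congr 1
        ext y
        rw [← hker, ← integral_const_mul]
        congr 1
        ext ξ
        ring
    _ = ∫ y, F (x - y) * (Metric.closedBall (0 : ℚ_[q] × ℚ_[q]) ((q : ℝ) ^ N)⁻¹).indicator
        (fun _ => (((μ.prod μ).real B : ℝ) : ℂ)) y ∂(μ.prod μ) := by
        rw [← integral_sub_left_eq_self _ _ x]
        congr 1
        ext y
        simp
    _ = ∫ y, (Metric.closedBall (0 : ℚ_[q] × ℚ_[q]) ((q : ℝ) ^ N)⁻¹).indicator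
        (fun _ => F x * (((μ.prod μ).real B : ℝ) : ℂ)) y ∂(μ.prod μ) := by
        congr 1
        ext y
        by_cases hy : y ∈ Metric.closedBall (0 : ℚ_[q] × ℚ_[q]) ((q : ℝ) ^ N)⁻¹
        · rw [Set.indicator_of_mem hy, Set.indicator_of_mem hy, sub_eq_add_neg, h.1 x (-y)]
          rw [norm_neg]
          have : ‖y‖ ≤ ((q : ℝ) ^ N)⁻¹ := by simpa using hy
          exact this.trans hNr
        · rw [Set.indicator_of_notMem hy, Set.indicator_of_notMem hy, mul_zero]
    _ = F x := by
        rw [integral_indicator Metric.isClosed_closedBall.measurableSet, setIntegral_const,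
          Complex.real_smul, mul_left_comm, ← Complex.ofReal_mul, mul_comm (Measure.real _ _), hvol]
        simp

theorem sum_proj (hχ : ChiOK χ) (μ : Measure ℚ_[q]) [μ.IsAddHaarMeasure] [SigmaFinite μ]
    (hμ : μ {x : ℚ_[q] | ‖x‖ ≤ 1} = 1) {r : ℝ}
    (hr : 0 < r) {F : ℚ_[q] × ℚ_[q] → ℂ} (h : Gd r F) (m : ℕ)
    (hs : ∀ p : ℚ_[q] × ℚ_[q],
        ¬ (‖p.1‖ ≤ 1 ∧ ‖p.2 - p.1 ^ 2‖ ≤ (q : ℝ) ^ (-((2 * m : ℕ) : ℤ))) →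
        qpFourier q μ χ F p = 0) (x : ℚ_[q] × ℚ_[q]) :
    F x = ∑ c ∈ Finset.range (q ^ m), qpProj q μ χ F (qpItv q m c) x := by
  have hq := qpos (q := q)
  have hpos : 0 < min (r / q) ((q : ℝ) ^ (-(m : ℤ))) := lt_min (by positivity) (by positivity)
  have hsum : ∀ ξ, qpFourier q μ χ F ξ = ∑ c ∈ Finset.range (q ^ m), Gc q μ χ m F c ξ := by
    intro ξ
    unfold Gc
    by_cases hξ : ‖ξ.1‖ ≤ 1 ∧ ‖ξ.2 - ξ.1 ^ 2‖ ≤ (q : ℝ) ^ (-((2 * m : ℕ) : ℤ))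
    swap
    · classical
      rw [hs ξ hξ]
      exact (Finset.sum_eq_zero fun c _ => by rw [Set.indicator_apply, hs ξ hξ, ite_self]).symm
    obtain ⟨a, ha, haξ⟩ : ∃ a < q ^ m, ‖ξ.1 - (a : ℚ_[q])‖ ≤ (q : ℝ) ^ (-(m : ℤ)) := by
      obtain ⟨z, hz⟩ : ∃ z : ℤ_[q], (z : ℚ_[q]) = ξ.1 := ⟨⟨ξ.1, hξ.1⟩, rfl⟩
      refine ⟨PadicInt.appr z m, PadicInt.appr_lt _ _, ?_⟩
      have := (PadicInt.norm_le_pow_iff_mem_span_pow _ _).2 (PadicInt.appr_spec m z)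
      rw [PadicInt.norm_def, PadicInt.coe_sub, PadicInt.coe_natCast, hz] at this
      exact this
    rw [Finset.sum_eq_single a]
    · rw [Set.indicator_of_mem]
      simpa [qpItv] using haξ
    · intro c hc hca
      apply Set.indicator_of_notMem
      intro hc2
      have hc3 : ‖ξ.1 - (c : ℚ_[q])‖ ≤ (q : ℝ) ^ (-(m : ℤ)) := by simpa [qpItv] using hc2
      have := norm_sub3 haξ hc3
      rw [show ξ.1 - a - (ξ.1 - c) = (c : ℚ_[q]) - a by ring, norm_sub_le_iff] at this
      exact hca (Nat.ModEq.eq_of_lt_of_lt this (Finset.mem_range.1 hc) ha)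
    · intro hc
      exact absurd (Finset.mem_range.2 ha) hc
  rw [← inversion hχ μ hμ hr h x]
  simp only [proj_eq]
  unfold iF
  rw [← integral_finsetSum]
  · congr 1
    ext ξ
    rw [hsum, Finset.sum_mul]
  · intro c _
    refine ((gd_Gc hχ μ hr h m c).integrable hpos μ).mul_bdd (c := 1) ?_
      (Filter.Eventually.of_forall fun p => (hχ.norm _).le)
    exact (hχ.continuous.comp (by fun_prop)).aestronglyMeasurable

end FourierPart

/-- **L²–L∞ decoupling for the q-adic parabola.** For every odd prime `q` and `ε > 0` there is
`C` such that for `R = q^{2m}` and Schwartz `F` with Fourier support in `Ξ_{1/R}`,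
`∫ |F|⁶ ≤ C (log R)^{12+ε} (∑_τ ‖F_τ‖_∞²)² (∑_τ ∫ |F_τ|²)`,
the sums being over intervals `τ ⊂ ℤ_q` of length `R^{-1/2}`. -/
theorem L2Linfty_decoupling (q : ℕ) [Fact q.Prime] (hq2 : q ≠ 2)
    (μ : Measure ℚ_[q]) [μ.IsAddHaarMeasure] [SigmaFinite μ]
    (hμ : μ {x : ℚ_[q] | ‖x‖ ≤ 1} = 1)
    (χ : ℚ_[q] → ℂ)
    (hχ_mul : ∀ x y : ℚ_[q], χ (x + y) = χ x * χ y)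
    (hχ_norm : ∀ x : ℚ_[q], ‖χ x‖ = 1)
    (hχ_triv : ∀ x : ℚ_[q], ‖x‖ ≤ 1 → χ x = 1)
    (hχ_nontriv : ∃ x : ℚ_[q], ‖x‖ ≤ (q : ℝ) ∧ χ x ≠ 1)
    (ε : ℝ) (hε : 0 < ε) :
    ∃ C : ℝ, 0 < C ∧ ∀ m : ℕ, 1 ≤ m → ∀ F : ℚ_[q] × ℚ_[q] → ℂ,
      IsLocallyConstant F → HasCompactSupport F →
      (∀ p : ℚ_[q] × ℚ_[q],
        ¬ (‖p.1‖ ≤ 1 ∧ ‖p.2 - p.1 ^ 2‖ ≤ (q : ℝ) ^ (-((2 * m : ℕ) : ℤ))) →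
        qpFourier q μ χ F p = 0) →
      ∫ x, ‖F x‖ ^ 6 ∂(μ.prod μ)
        ≤ C * (Real.log ((q : ℝ) ^ (2 * m))) ^ ((12 : ℝ) + ε) *
            (∑ a ∈ Finset.range (q ^ m), (⨆ x, ‖qpProj q μ χ F (qpItv q m a) x‖) ^ 2) ^ 2 *
            ∑ a ∈ Finset.range (q ^ m),
              ∫ x, ‖qpProj q μ χ F (qpItv q m a) x‖ ^ 2 ∂(μ.prod μ) := by
  have hχ : ChiOK χ := ⟨hχ_mul, hχ_norm, hχ_triv, hχ_nontriv⟩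
  have hq := qpos (q := q)
  refine ⟨134369280 * (q : ℝ) ^ 16 + 730, by positivity, ?_⟩
  intro m hm F hF1 hF2 hs
  obtain ⟨r, hr, hG⟩ := gd_of_schwartz hF1 hF2
  have hr1 : 0 < min (r / q) ((q : ℝ) ^ (-(m : ℤ))) := lt_min (by positivity) (by positivity)
  have hr2 : 0 < min (r / q) ((q : ℝ) ^ (-(m : ℤ))) / q := by positivity
  have hgc : ∀ c : ℕ, Gd (min (r / q) ((q : ℝ) ^ (-(m : ℤ))) / q)
      (qpProj q μ χ F (qpItv q m c)) := by
    intro c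
    rw [proj_eq]
    exact gd_iF hχ μ hr1 (gd_Gc hχ μ hr hG m c)
  have hle : ∀ (c : ℕ) x, ‖qpProj q μ χ F (qpItv q m c) x‖
      ≤ ⨆ x, ‖qpProj q μ χ F (qpItv q m c) x‖ := by
    intro c x
    exact le_ciSup ((hgc c).bdd hr2) x
  set A : ℝ := ∑ a ∈ Finset.range (q ^ m), (⨆ x, ‖qpProj q μ χ F (qpItv q m a) x‖) ^ 2 with hA
  have hFA : ∀ x, ∑ c ∈ Finset.range (q ^ m), ‖qpProj q μ χ F (qpItv q m c) x‖ ^ 2 ≤ A := by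
    intro x
    exact Finset.sum_le_sum fun c _ => pow_le_pow_left₀ (norm_nonneg _) (hle c x) 2
  have hA0 : 0 ≤ A := Finset.sum_nonneg fun c _ => sq_nonneg _
  have hsp := sum_proj hχ μ hμ hr hG m hs
  rcases hA0.eq_or_lt with hz | hApos
  · have hF0 : ∀ x, F x = 0 := by
      intro x
      rw [hsp x]
      have h0 : ∑ c ∈ Finset.range (q ^ m), ‖qpProj q μ χ F (qpItv q m c) x‖ ^ 2 = 0 :=
        le_antisymm ((hFA x).trans hz.symm.le) (Finset.sum_nonneg fun c _ => sq_nonneg _)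
      rw [Finset.sum_eq_zero_iff_of_nonneg (fun c _ => sq_nonneg _)] at h0
      exact Finset.sum_eq_zero fun c hc => by simpa using h0 c hc
    simp [hF0, ← hz]
  · have hmain := main_abs hχ hq2 hm hr2 μ (fun c => qpProj q μ χ F (qpItv q m c))
      (fun c => qi_proj hχ μ m c hs) hgc hApos hFA
    simp only [← hsp] at hmain
    refine hmain.trans ?_
    have hm1 : (1 : ℝ) ≤ m := by exact_mod_cast hm
    have hlog : (m : ℝ) ≤ Real.log ((q : ℝ) ^ (2 * m)) := by
      rw [Real.log_pow]
      have h2 : Real.log 2 ≤ Real.log q :=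
        Real.log_le_log (by norm_num) (by exact_mod_cast (Fact.out : q.Prime).two_le)
      have h3 := Real.log_two_gt_d9
      push_cast
      nlinarith
    have hpow : (m : ℝ) ^ 11 ≤ (Real.log ((q : ℝ) ^ (2 * m))) ^ ((12 : ℝ) + ε) := by
      calc (m : ℝ) ^ 11 = (m : ℝ) ^ (11 : ℝ) := by
            rw [← Real.rpow_natCast]; norm_num
        _ ≤ (m : ℝ) ^ ((12 : ℝ) + ε) :=
            Real.rpow_le_rpow_of_exponent_le hm1 (by linarith)
        _ ≤ _ := Real.rpow_le_rpow (by positivity) hlog (by positivity)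
    have hs0 : 0 ≤ ∑ a ∈ Finset.range (q ^ m),
        ∫ x, ‖qpProj q μ χ F (qpItv q m a) x‖ ^ 2 ∂(μ.prod μ) :=
      Finset.sum_nonneg fun c _ => integral_nonneg fun x => sq_nonneg _
    gcongr
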